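/- arXiv:2203.12006 — 2 statements merged into one kernel-verified Lean document; each statement's English description precedes it below -/
import Mathlib

section
/- There exists a constant c > 0 such that for all sufficiently large N one has Ξ(N) ≥ c·N/log log N. -/
/-- `Xi w N` counts the integers in `[1, N]` that are not representable as `n + w n`
for some `n ≥ 1`. -/
noncomputable def Xi (w : ℕ → ℕ) (N : ℕ) : ℕ :=
  (Set.Icc 1 N ∩ {k : ℕ | ¬ ∃ n : ℕ, 1 ≤ n ∧ n + w n = k}).ncard

section XiHelpers
open Finset
open scoped ArithmeticFunction


lemma primePow_sum_le (F : ℕ → ℝ) (h0 : ∀ n, 0 ≤ F n) (h1 : ∀ p, p.Prime → F p ≤ 1)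
    (h2 : ∀ p, IsPrimePow p → F p ≤ 2) (K : ℕ) :
    ∑ t ∈ Ioc 0 K, (if IsPrimePow t then F t * Real.log t else 0) ≤ 100 * (K : ℝ) := by
  rcases Nat.eq_zero_or_pos K with rfl | hK
  · simp
  have hK1 : (1 : ℝ) ≤ K := by exact_mod_cast hK
  have hlogK : 0 ≤ Real.log K := Real.log_nonneg hK1
  have hl2 : (0.69 : ℝ) < Real.log 2 := by linarith [Real.log_two_gt_d9]
  have hl2' : Real.log 2 < (0.7 : ℝ) := by linarith [Real.log_two_lt_d9]
  have key : ∑ t ∈ Ioc 0 K, (if IsPrimePow t then F t * Real.log t else 0) ≤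
      Chebyshev.theta K + (2 * Real.log K / Real.log 2) * (Chebyshev.psi K - Chebyshev.theta K) := by
    have hA : ∀ t ∈ Ioc 0 K, (if IsPrimePow t then F t * Real.log t else 0) ≤
      (if t.Prime then Real.log t else 0) + (2 * Real.log K / Real.log 2) *
        (ArithmeticFunction.vonMangoldt t - (if t.Prime then Real.log t else 0)) := by
      intro t ht
      rw [mem_Ioc] at ht
      have ht1 : (1 : ℝ) ≤ t := by exact_mod_cast ht.1
      have hlt : 0 ≤ Real.log t := Real.log_nonneg ht1
      have hltK : Real.log t ≤ Real.log K := Real.log_le_log (by linarith) (by exact_mod_cast ht.2)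
      by_cases hp : t.Prime
      · simp only [hp, hp.isPrimePow, if_true, ArithmeticFunction.vonMangoldt_apply_prime hp, sub_self, mul_zero, add_zero]
        nlinarith [h1 t hp]
      · simp only [hp, if_false, zero_add, sub_zero]
        by_cases hpp : IsPrimePow t
        · simp only [hpp, if_true]
          have h3 : Real.log 2 ≤ ArithmeticFunction.vonMangoldt t := by
            rw [ArithmeticFunction.vonMangoldt_apply, if_pos hpp]
            apply Real.log_le_log (by norm_num)
            exact_mod_cast (Nat.minFac_prime hpp.ne_one).two_le
          calc F t * Real.log t ≤ 2 * Real.log K := mul_le_mul (h2 t hpp) hltK hlt (by norm_num)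
            _ = 2 * Real.log K / Real.log 2 * Real.log 2 := by field_simp
            _ ≤ _ := by gcongr
        · simp only [hpp, if_false]
          have := @ArithmeticFunction.vonMangoldt_nonneg t
          positivity
    refine (sum_le_sum hA).trans ?_
    rw [sum_add_distrib, ← mul_sum, sum_sub_distrib]
    simp only [Chebyshev.theta, Chebyshev.psi, Nat.floor_natCast, sum_filter]
    exact le_rfl
  refine key.trans ?_
  have hth := Chebyshev.theta_le_log4_mul_x (x := K) (by positivity)
  have hps := Chebyshev.psi_sub_theta_le hK1
  have h4 : Real.log 4 = 2 * Real.log 2 := by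
    rw [show (4:ℝ) = 2 ^ 2 by norm_num, Real.log_pow]; norm_num
  set s := Real.sqrt (Real.sqrt K) with hs
  have hs2 : s ^ 2 = Real.sqrt K := Real.sq_sqrt (Real.sqrt_nonneg _)
  have hs4 : s ^ 4 = K := by
    rw [show s ^ 4 = (s ^ 2) ^ 2 by ring, hs2, Real.sq_sqrt (by positivity)]
  have hspos : 0 < s := by positivity
  have hlog : Real.log K ≤ 4 * s := by
    rw [← hs4, Real.log_pow]
    have := Real.log_le_sub_one_of_pos hspos
    push_cast; linarith
  have : (2 * Real.log K / Real.log 2) * (Chebyshev.psi K - Chebyshev.theta K) ≤ 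
     (2 * (4 * s) / 0.69) * (2 * s ^ 2 * (4 * s)) := by
    rw [← hs2] at hps
    apply mul_le_mul
    · gcongr
    · refine hps.trans ?_
      gcongr
    · exact sub_nonneg.2 (Chebyshev.theta_le_psi _)
    · positivity
  have e : (2 * (4 * s) / 0.69) * (2 * s ^ 2 * (4 * s)) = 64 / 0.69 * (K:ℝ) := by rw [← hs4]; ring
  rw [e] at this
  nlinarith

lemma log_sum_le (F : ArithmeticFunction ℝ) (hF : F.IsMultiplicative) (h0 : ∀ n, 0 ≤ F n)
    (h1 : ∀ p, p.Prime → F p ≤ 1) (h2 : ∀ p, IsPrimePow p → F p ≤ 2) (N : ℕ) :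
    ∑ d ∈ Ioc 0 N, F d * Real.log d ≤ 100 * N * ∑ m ∈ Ioc 0 N, F m / m := by
  let W : ArithmeticFunction ℝ := ⟨fun t => if IsPrimePow t then F t * Real.log t else 0, by simp⟩
  have hW : ∀ t, W t = if IsPrimePow t then F t * Real.log t else 0 := fun t => rfl
  have hW0 : ∀ t, 0 ≤ W t := by
    intro t; rw [hW]; split_ifs
    · exact mul_nonneg (h0 _) (Real.log_natCast_nonneg _)
    · exact le_rfl
  have step : ∀ d ∈ Ioc 0 N, F d * Real.log d ≤ (F * W) d := by
    intro d hd
    have hd0 : d ≠ 0 := by rw [mem_Ioc] at hd; omega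
    have hlog : Real.log d = ∑ p ∈ d.primeFactors, Real.log ((p ^ d.factorization p : ℕ) : ℝ) := by
      conv_lhs => rw [← Nat.factorization_prod_pow_eq_self hd0]
      rw [Finsupp.prod, Nat.cast_prod, Real.log_prod]
      · rfl
      · intro p hp
        have := (Nat.prime_of_mem_primeFactors hp).pos
        positivity
    rw [hlog, mul_sum, ArithmeticFunction.mul_apply]
    have e : ∀ p ∈ d.primeFactors, F d * Real.log ((p ^ d.factorization p : ℕ) : ℝ) =
        F (d / p ^ d.factorization p) * W (p ^ d.factorization p) := by
      intro p hp
      have hpp := Nat.prime_of_mem_primeFactors hp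
      have hk : d.factorization p ≠ 0 := by
        rw [← Finsupp.mem_support_iff]; exact hp
      rw [hW, if_pos ((hpp.isPrimePow).pow hk), ← mul_assoc, mul_comm (F (d / _)), ← hF.map_mul_of_coprime, Nat.ordProj_mul_ordCompl_eq_self]
      exact (Nat.coprime_ordCompl hpp hd0).pow_left _
    rw [sum_congr rfl e]
    let i : ℕ → ℕ × ℕ := fun p => (d / p ^ d.factorization p, p ^ d.factorization p)
    have hinj : Set.InjOn i d.primeFactors := by
      intro p hp p' hp' h
      have h3 : p ^ d.factorization p = p' ^ d.factorization p' := congrArg Prod.snd h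
      have hpp := Nat.prime_of_mem_primeFactors hp
      have hpp' := Nat.prime_of_mem_primeFactors hp'
      have hk : d.factorization p ≠ 0 := by
        rw [← Finsupp.mem_support_iff]; exact hp
      have : p ∣ p' ^ d.factorization p' := h3 ▸ dvd_pow_self p hk
      exact (Nat.prime_dvd_prime_iff_eq hpp hpp').1 (hpp.dvd_of_dvd_pow this)
    have := sum_image (f := fun x : ℕ × ℕ => F x.1 * W x.2) hinj
    rw [← this]
    apply sum_le_sum_of_subset_of_nonneg
    · intro x hx
      obtain ⟨p, hp, rfl⟩ := mem_image.1 hx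
      rw [Nat.mem_divisorsAntidiagonal]
      exact ⟨by simp only [i]; rw [mul_comm]; exact Nat.ordProj_mul_ordCompl_eq_self d p, hd0⟩
    · intro x _ _
      exact mul_nonneg (h0 _) (hW0 _)
  refine (sum_le_sum step).trans ?_
  rw [ArithmeticFunction.sum_Ioc_mul_eq_sum_sum, mul_sum]
  apply sum_le_sum
  intro m hm
  rw [mem_Ioc] at hm
  have := primePow_sum_le F h0 h1 h2 (N / m)
  have hm0 : (0:ℝ) < m := by exact_mod_cast hm.1
  have h3 : ((N / m : ℕ) : ℝ) ≤ N / m := Nat.cast_div_le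
  calc F m * ∑ t ∈ Ioc 0 (N / m), W t ≤ F m * (100 * (N / m)) := by
        apply mul_le_mul_of_nonneg_left _ (h0 m)
        refine this.trans ?_
        linarith
    _ = _ := by field_simp

lemma sum_F_le (F : ArithmeticFunction ℝ) (hF : F.IsMultiplicative) (h0 : ∀ n, 0 ≤ F n)
    (h1 : ∀ p, p.Prime → F p ≤ 1) (h2 : ∀ p, IsPrimePow p → F p ≤ 2) (N : ℕ) :
    Real.log N * ∑ d ∈ Ioc 0 N, F d ≤ 101 * N * ∑ m ∈ Ioc 0 N, F m / m := by
  have h := log_sum_le F hF h0 h1 h2 N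
  have h3 : ∑ d ∈ Ioc 0 N, F d * (Real.log N - Real.log d) ≤ N * ∑ m ∈ Ioc 0 N, F m / m := by
    rw [mul_sum]
    apply sum_le_sum
    intro m hm
    rw [mem_Ioc] at hm
    have hm0 : (0:ℝ) < m := by exact_mod_cast hm.1
    have hN0 : (0:ℝ) < N := by exact_mod_cast hm.1.trans_le hm.2
    rw [← Real.log_div hN0.ne' hm0.ne']
    have := Real.log_le_sub_one_of_pos (div_pos hN0 hm0)
    calc F m * Real.log (N / m) ≤ F m * (N / m) := by
          apply mul_le_mul_of_nonneg_left _ (h0 m); linarith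
      _ = _ := by field_simp
  simp only [mul_sub, sum_sub_distrib] at h3
  rw [← sum_mul] at h3
  linarith


lemma euler_le (F : ArithmeticFunction ℝ) (hF : F.IsMultiplicative) (h0 : ∀ n, 0 ≤ F n) (η : ℝ)
    (h1 : ∀ p, p.Prime → F p ≤ η) (h2 : ∀ p, IsPrimePow p → F p ≤ 2) (N : ℕ) :
    ∑ m ∈ Ioc 0 N, F m / m ≤
      Real.exp (η * (∑ p ∈ (Ioc 0 N).filter Nat.Prime, (1 : ℝ) / p) + 8) := by
  let f : ℕ → ℝ := fun m => F m / m
  have hf0 : ∀ m, 0 ≤ f m := fun m => div_nonneg (h0 m) (by positivity)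
  have hf1 : f 1 = 1 := by simp [f, hF.map_one]
  have hfm : ∀ {m n : ℕ}, Nat.Coprime m n → f (m * n) = f m * f n := by
    intro m n h
    simp only [f]
    rw [hF.map_mul_of_coprime h]; push_cast; rw [div_mul_div_comm]
  have hb : ∀ {p : ℕ}, p.Prime → ∀ n : ℕ, f (p ^ (n + 1)) ≤ 2 / (p : ℝ) * (1 / (p : ℝ)) ^ n := by
    intro p hp n
    have hp0 : (0 : ℝ) < p := by exact_mod_cast hp.pos
    have := h2 (p ^ (n + 1)) (hp.isPrimePow.pow (by omega))
    simp only [f]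
    rw [show 2 / (p : ℝ) * (1 / (p : ℝ)) ^ n = 2 / (p : ℝ) ^ (n + 1) by
      rw [one_div, inv_pow, pow_succ]; field_simp]
    push_cast
    gcongr
  have hgeo : ∀ {p : ℕ}, p.Prime → Summable (fun n : ℕ => (1 / (p : ℝ)) ^ n) := by
    intro p hp
    apply summable_geometric_of_lt_one (by positivity)
    rw [div_lt_one (by exact_mod_cast hp.pos)]
    exact_mod_cast hp.one_lt
  have hsum : ∀ {p : ℕ}, p.Prime → Summable (fun n : ℕ => ‖f (p ^ n)‖) := by
    intro p hp
    rw [← summable_nat_add_iff 1]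
    refine Summable.of_nonneg_of_le (fun _ => norm_nonneg _) (fun n => ?_)
      ((hgeo hp).mul_left (2 / (p : ℝ)))
    rw [Real.norm_of_nonneg (hf0 _)]
    exact hb hp n
  obtain ⟨hs, hh⟩ := EulerProduct.summable_and_hasSum_smoothNumbers_prod_primesBelow_tsum
    hf1 hfm hsum (N + 1)
  have hle : ∑ m ∈ Ioc 0 N, f m ≤ ∏ p ∈ (N + 1).primesBelow, ∑' n : ℕ, f (p ^ n) := by
    let s : Finset (N + 1).smoothNumbers := (Ioc 0 N).subtype (· ∈ (N + 1).smoothNumbers)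
    have hsm := sum_le_hasSum s (fun i _ => hf0 i) hh
    have : ∑ i ∈ s, f i = ∑ m ∈ Ioc 0 N, f m := by
      rw [Finset.sum_subtype_of_mem (p := (· ∈ (N + 1).smoothNumbers))]
      intro x hx
      rw [mem_Ioc] at hx
      exact Nat.mem_smoothNumbers_of_lt hx.1 (by omega)
    rw [← this]; exact hsm
  refine hle.trans ?_
  have hfac : ∀ p ∈ (N + 1).primesBelow, ∑' n : ℕ, f (p ^ n) ≤
      Real.exp (η * (1 / (p : ℝ)) + 4 / (p : ℝ) ^ 2) := by
    intro p hp
    have hp := Nat.prime_of_mem_primesBelow hp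
    have hp2 : (2 : ℝ) ≤ p := by exact_mod_cast hp.two_le
    have hsm : Summable (fun n : ℕ => f (p ^ n)) := (hsum hp).of_norm
    rw [← hsm.sum_add_tsum_nat_add 2]
    have htail : ∑' n : ℕ, f (p ^ (n + 2)) ≤ 4 / (p : ℝ) ^ 2 := by
      have hg : Summable (fun n : ℕ => 2 / (p : ℝ) ^ 2 * (1 / (p : ℝ)) ^ n) := (hgeo hp).mul_left _
      calc ∑' n : ℕ, f (p ^ (n + 2)) ≤ ∑' n : ℕ, 2 / (p : ℝ) ^ 2 * (1 / (p : ℝ)) ^ n := by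
            apply Summable.tsum_le_tsum _ ((summable_nat_add_iff 2).2 hsm) hg
            intro n
            refine (hb hp (n + 1)).trans (le_of_eq ?_)
            rw [pow_succ]; field_simp
        _ = 2 / (p : ℝ) ^ 2 * (1 - 1 / (p : ℝ))⁻¹ := by
            rw [tsum_mul_left, tsum_geometric_of_lt_one (by positivity)]
            rw [div_lt_one (by linarith)]; linarith
        _ ≤ 2 / (p : ℝ) ^ 2 * 2 := by
            gcongr
            rw [inv_le_comm₀ _ (by norm_num)]
            · have : 1 / (p : ℝ) ≤ 1 / 2 := one_div_le_one_div_of_le (by norm_num) hp2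
              linarith
            · have : 1 / (p : ℝ) ≤ 1 / 2 := one_div_le_one_div_of_le (by norm_num) hp2
              linarith
        _ = _ := by ring
    have h3 : f p ≤ η * (1 / (p : ℝ)) := by
      simp only [f]
      rw [mul_one_div]
      have := h1 p hp
      gcongr
    have h4 : ∑ i ∈ range 2, f (p ^ i) = 1 + f p := by
      simp [sum_range_succ, hf1]
    rw [h4]
    have := Real.add_one_le_exp (η * (1 / (p : ℝ)) + 4 / (p : ℝ) ^ 2)
    linarith
  refine (prod_le_prod (fun p _ => tsum_nonneg fun n => hf0 _) hfac).trans ?_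
  rw [← Real.exp_sum]
  apply Real.exp_le_exp.2
  have hset : (N + 1).primesBelow = (Ioc 0 N).filter Nat.Prime := by
    ext p
    simp only [Nat.mem_primesBelow, mem_filter, mem_Ioc]
    constructor
    · rintro ⟨a, b⟩; exact ⟨⟨b.pos, by omega⟩, b⟩
    · rintro ⟨⟨a, b⟩, c⟩; exact ⟨by omega, c⟩
  rw [hset, sum_add_distrib, ← mul_sum]
  have h5 : ∑ p ∈ (Ioc 0 N).filter Nat.Prime, 4 / (p : ℝ) ^ 2 ≤ 8 := by
    have h6 : ∀ K : ℕ, ∑ p ∈ Ioc 0 (K + 1), 4 / (p : ℝ) ^ 2 ≤ 8 - 4 / (K + 1 : ℝ) := by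
      intro K
      induction K with
      | zero => norm_num
      | succ k ih =>
        rw [sum_Ioc_succ_top (by omega)]
        have : 4 / ((k + 1 + 1 : ℕ) : ℝ) ^ 2 ≤ 4 / (k + 1 : ℝ) - 4 / ((k + 1 : ℕ) + 1 : ℝ) := by
          push_cast
          rw [div_sub_div _ _ (by positivity) (by positivity),
            div_le_div_iff₀ (by positivity) (by positivity)]
          nlinarith
        linarith
    refine (sum_le_sum_of_subset_of_nonneg (filter_subset _ _) (fun i _ _ => by positivity)).trans ?_
    rcases N with _ | K
    · simp
    · have h7 := h6 K
      have : (0 : ℝ) ≤ 4 / (K + 1 : ℝ) := by positivity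
      linarith
  linarith

lemma geom_bound (u : ℂ) (q : ℕ) (hq : 0 < q) (hu : u ≠ 1) (huq : u ^ q = 1) (K : ℕ) :
    ‖∑ m ∈ Ioc 0 K, u ^ m‖ ≤ q := by
  have hn : ‖u‖ = 1 := Complex.norm_eq_one_of_pow_eq_one huq hq.ne'
  have h1 : ∀ K : ℕ, ∑ m ∈ Ioc 0 K, u ^ m = u * ((u ^ K - 1) / (u - 1)) := by
    intro K
    rw [← geom_sum_eq hu]
    induction K with
    | zero => simp
    | succ k ih =>
      rw [sum_Ioc_succ_top (by omega), ih, sum_range_succ]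
      ring
  have h2 : ∑ m ∈ Ioc 0 K, u ^ m = ∑ m ∈ Ioc 0 (K % q), u ^ m := by
    rw [h1, h1]
    conv_lhs => rw [← Nat.div_add_mod K q, pow_add, pow_mul, huq, one_pow, one_mul]
  rw [h2]
  refine (norm_sum_le _ _).trans ?_
  simp only [norm_pow, hn, one_pow, sum_const, Nat.card_Ioc, nsmul_eq_mul, mul_one]
  exact_mod_cast (Nat.mod_lt K hq).le

lemma xi_ge (w : ℕ → ℕ) (N : ℕ) (z : ℂ) (q : ℕ) (hq : 0 < q) (hz : z ≠ 1) (hzq : z ^ q = 1) :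
    ‖∑ n ∈ Ioc 0 N, z ^ (n + w n)‖ ≤ q + 2 * Xi w N := by
  classical
  have hn : ‖z‖ = 1 := Complex.norm_eq_one_of_pow_eq_one hzq hq.ne'
  set A := Ioc 0 N with hA
  set I := A.filter (fun k => ∃ n : ℕ, 1 ≤ n ∧ n + w n = k) with hI
  have hXi : Xi w N = (A \ I).card := by
    rw [Xi, ← Set.ncard_coe_finset]
    congr 1
    ext k
    simp only [Set.mem_inter_iff, Set.mem_Icc, Set.mem_ofPred_eq, hI, hA, coe_sdiff, coe_filter,
      Set.mem_sdiff, mem_coe, mem_Ioc, Nat.succ_le_iff]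
    constructor
    · rintro ⟨a, b⟩; exact ⟨a, fun h => b h.2⟩
    · rintro ⟨a, b⟩; exact ⟨a, fun h => b ⟨a, h⟩⟩
  have hch : ∀ k ∈ I, ∃ n, n ∈ A ∧ n + w n = k := by
    intro k hk
    simp only [hI, mem_filter, hA, mem_Ioc] at hk ⊢
    obtain ⟨⟨a, b⟩, n, hn1, hn2⟩ := hk
    exact ⟨n, ⟨by omega, by omega⟩, hn2⟩
  choose! s hs using hch
  have hinj : Set.InjOn s I := by
    intro a ha b hb hab
    rw [← (hs a ha).2, ← (hs b hb).2, hab]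
  set J := I.image s with hJ
  have hJA : J ⊆ A := by
    intro x hx
    obtain ⟨k, hk, rfl⟩ := mem_image.1 hx
    exact (hs k hk).1
  have hIA : I ⊆ A := filter_subset _ _
  have hcard : (A \ J).card = (A \ I).card := by
    rw [card_sdiff_of_subset hJA, card_sdiff_of_subset hIA, card_image_of_injOn hinj]
  have hsumJ : ∑ n ∈ J, z ^ (n + w n) = ∑ k ∈ I, z ^ k := by
    rw [hJ, sum_image hinj]
    exact sum_congr rfl fun k hk => by rw [(hs k hk).2]
  have e1 := sum_sdiff (f := fun n => z ^ (n + w n)) hJA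
  have e2 := sum_sdiff (f := fun n => z ^ n) hIA
  have e3 : ∑ n ∈ A, z ^ (n + w n) = ∑ n ∈ A \ J, z ^ (n + w n) + (∑ n ∈ A, z ^ n - ∑ n ∈ A \ I, z ^ n) := by
    rw [← e1, ← e2, hsumJ]; ring
  have b1 : ‖∑ n ∈ A \ J, z ^ (n + w n)‖ ≤ Xi w N := by
    refine (norm_sum_le _ _).trans ?_
    simp [hn, hcard, hXi]
  have b2 : ‖∑ n ∈ A \ I, z ^ n‖ ≤ Xi w N := by
    refine (norm_sum_le _ _).trans ?_
    simp [hn, hXi]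
  have b3 := geom_bound z q hq hz hzq N
  rw [e3]
  calc _ ≤ ‖∑ n ∈ A \ J, z ^ (n + w n)‖ + (‖∑ n ∈ A, z ^ n‖ + ‖∑ n ∈ A \ I, z ^ n‖) :=
        (norm_add_le _ _).trans (by gcongr; exact norm_sub_le _ _)
    _ ≤ _ := by linarith

lemma tk (M : ℕ) :
    ∑ n ∈ Ioc 0 M, ((n.primeFactors.card : ℝ) - ∑ p ∈ (Ioc 0 M).filter Nat.Prime, (1 : ℝ) / p) ^ 2
      ≤ 3 * (∑ p ∈ (Ioc 0 M).filter Nat.Prime, (1 : ℝ) / p) * M := by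
  set P := (Ioc 0 M).filter Nat.Prime with hP
  set μ := ∑ p ∈ P, (1 : ℝ) / p with hμ
  have hμ0 : 0 ≤ μ := sum_nonneg fun _ _ => by positivity
  have hom : ∀ n ∈ Ioc 0 M, (n.primeFactors.card : ℝ) = ∑ p ∈ P, if p ∣ n then (1:ℝ) else 0 := by
    intro n hn
    rw [mem_Ioc] at hn
    rw [← sum_filter, sum_const, nsmul_eq_mul, mul_one]
    congr 2
    ext p
    simp only [Nat.mem_primeFactors, hP, mem_filter, mem_Ioc]
    constructor
    · rintro ⟨a, b, c⟩
      exact ⟨⟨⟨a.pos, (Nat.le_of_dvd hn.1 b).trans hn.2⟩, a⟩, b⟩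
    · rintro ⟨⟨_, a⟩, b⟩
      exact ⟨a, b, by omega⟩
  have hcnt : ∀ d : ℕ, ∑ n ∈ Ioc 0 M, (if d ∣ n then (1:ℝ) else 0) = ((M / d : ℕ) : ℝ) := by
    intro d
    rw [← sum_filter, sum_const, nsmul_eq_mul, mul_one, Nat.Ioc_filter_dvd_card_eq_div]
  have hS1 : M * μ - M ≤ ∑ n ∈ Ioc 0 M, (n.primeFactors.card : ℝ) := by
    rw [sum_congr rfl hom, sum_comm]
    simp only [hcnt]
    have : ∑ p ∈ P, ((M : ℝ) * (1 / p) - 1) ≤ ∑ p ∈ P, ((M / p : ℕ) : ℝ) := by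
      apply sum_le_sum
      intro p _
      have := Nat.lt_floor_add_one ((M : ℝ) / p)
      rw [Nat.floor_div_natCast, Nat.floor_natCast] at this
      rw [mul_one_div]
      linarith
    rw [sum_sub_distrib, ← mul_sum, sum_const, nsmul_eq_mul, mul_one] at this
    have hc : (P.card : ℝ) ≤ M := by
      have := card_filter_le (Ioc 0 M) Nat.Prime
      simp only [Nat.card_Ioc] at this
      exact_mod_cast this
    linarith
  have hS2 : ∑ n ∈ Ioc 0 M, (n.primeFactors.card : ℝ) ^ 2 ≤ M * (μ ^ 2 + μ) := by
    have : ∀ n ∈ Ioc 0 M, (n.primeFactors.card : ℝ) ^ 2 =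
        ∑ p ∈ P, ∑ p' ∈ P, if p ∣ n ∧ p' ∣ n then (1 : ℝ) else 0 := by
      intro n hn
      rw [hom n hn, sq, sum_mul_sum]
      refine sum_congr rfl fun p _ => sum_congr rfl fun p' _ => ?_
      split_ifs <;> simp_all
    rw [sum_congr rfl this, sum_comm]
    have h3 : ∀ p ∈ P, ∑ n ∈ Ioc 0 M, ∑ p' ∈ P, (if p ∣ n ∧ p' ∣ n then (1 : ℝ) else 0) ≤
        ∑ p' ∈ P, ((M : ℝ) * ((1 / p) * (1 / p')) + if p = p' then M * (1 / (p:ℝ)) else 0) := by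
      intro p hp
      rw [sum_comm]
      apply sum_le_sum
      intro p' hp'
      have hpp := (mem_filter.1 hp).2
      have hpp' := (mem_filter.1 hp').2
      by_cases h : p = p'
      · subst h
        simp only [and_self, hcnt, if_true]
        have : ((M / p : ℕ) : ℝ) ≤ M / p := Nat.cast_div_le
        have h9 : (0:ℝ) ≤ (M : ℝ) * ((1 / p) * (1 / p)) := by positivity
        have h8 : (M : ℝ) * (1 / (p : ℝ)) = M / p := by ring
        rw [h8]
        linarith
      · have hc : Nat.Coprime p p' := (Nat.coprime_primes hpp hpp').2 h
        have : ∀ n, (p ∣ n ∧ p' ∣ n) ↔ p * p' ∣ n := fun n =>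
          ⟨fun ⟨a, b⟩ => hc.mul_dvd_of_dvd_of_dvd a b, fun a => ⟨dvd_of_mul_right_dvd a, dvd_of_mul_left_dvd a⟩⟩
        simp only [this, hcnt, if_neg h, add_zero]
        have : ((M / (p * p') : ℕ) : ℝ) ≤ M / ((p * p' : ℕ) : ℝ) := Nat.cast_div_le
        refine this.trans (le_of_eq ?_)
        push_cast
        rw [one_div_mul_one_div, mul_one_div]
    refine (sum_le_sum h3).trans (le_of_eq ?_)
    simp only [sum_add_distrib, sum_ite_eq, ← mul_sum, ← sum_mul]
    rw [sum_ite_mem, inter_self, ← mul_sum, ← hμ]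
    ring
  have : ∑ n ∈ Ioc 0 M, ((n.primeFactors.card : ℝ) - μ) ^ 2 =
      ∑ n ∈ Ioc 0 M, (n.primeFactors.card : ℝ) ^ 2 - 2 * μ * ∑ n ∈ Ioc 0 M, (n.primeFactors.card : ℝ)
        + M * μ ^ 2 := by
    simp only [sub_sq, sum_add_distrib, sum_sub_distrib, sum_const, Nat.card_Ioc, nsmul_eq_mul, mul_sum]
    simp only [tsub_zero]
    congr 2
    exact sum_congr rfl fun _ _ => by ring
  rw [this]
  nlinarith

lemma nonsqfree (M : ℕ) : (((Ioc 0 M).filter (fun n => ¬ Squarefree n)).card : ℝ) ≤ 35 / 72 * M := by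
  classical
  have hsub : (Ioc 0 M).filter (fun n => ¬ Squarefree n) ⊆
      ((Ioc 0 M).filter (fun n => 4 ∣ n) ∪ (Ioc 0 M).filter (fun n => 9 ∣ n)) ∪
        (Ico 2 (M + 2)).biUnion (fun j => (Ioc 0 M).filter (fun n => (2 * j + 1) ^ 2 ∣ n)) := by
    intro n hn
    rw [mem_filter, Nat.squarefree_iff_prime_squarefree] at hn
    obtain ⟨hn1, hn2⟩ := hn
    push Not at hn2
    obtain ⟨p, hp, hd⟩ := hn2
    simp only [mem_union, mem_filter, mem_biUnion, hn1, true_and]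
    by_cases h2 : p = 2
    · subst h2; left; left; simpa using hd
    by_cases h3 : p = 3
    · subst h3; left; right; simpa using hd
    right
    obtain ⟨j, hj⟩ := hp.odd_of_ne_two h2
    have := hp.two_le
    rw [mem_Ioc] at hn1
    have h4 := Nat.le_of_dvd hn1.1 hd
    refine ⟨j, ?_, by rw [← hj, sq]; exact hd⟩
    rw [mem_Ico]
    constructor
    · omega
    · nlinarith
  have h1 : ((Ioc 0 M).filter (fun n => ¬ Squarefree n)).card ≤
      M / 4 + M / 9 + ∑ j ∈ Ico 2 (M + 2), M / (2 * j + 1) ^ 2 := by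
    refine (card_le_card hsub).trans ((card_union_le _ _).trans ?_)
    gcongr
    · refine (card_union_le _ _).trans ?_
      simp only [Nat.Ioc_filter_dvd_card_eq_div, le_refl]
    · refine card_biUnion_le.trans ?_
      simp only [Nat.Ioc_filter_dvd_card_eq_div, le_refl]
  have h2 : ∀ K : ℕ, ∑ j ∈ Ico 2 (K + 2), ((M / (2 * j + 1) ^ 2 : ℕ) : ℝ) ≤ M * (1 / 8 - 1 / (4 * (K + 2 : ℝ))) := by
    intro K
    induction K with
    | zero => norm_num
    | succ k ih =>
      rw [sum_Ico_succ_top (by omega)]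
      have a1 : ((M / (2 * (k + 2) + 1) ^ 2 : ℕ) : ℝ) ≤ M / (((2 * (k + 2) + 1) ^ 2 : ℕ) : ℝ) := Nat.cast_div_le
      have a2 : M / (((2 * (k + 2) + 1) ^ 2 : ℕ) : ℝ) ≤ M * (1 / (4 * (k + 2 : ℝ)) - 1 / (4 * ((k + 1 : ℕ) + 2 : ℝ))) := by
        rw [div_eq_mul_one_div]
        gcongr
        push_cast
        rw [div_sub_div _ _ (by positivity) (by positivity), div_le_div_iff₀ (by positivity) (by positivity)]
        nlinarith
      linarith
  have h3 := h2 M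
  have h4 : (0:ℝ) ≤ M * (1 / (4 * (M + 2 : ℝ))) := by positivity
  have h5 : ((M / 4 : ℕ) : ℝ) ≤ M / (4 : ℕ) := Nat.cast_div_le
  have h6 : ((M / 9 : ℕ) : ℝ) ≤ M / (9 : ℕ) := Nat.cast_div_le
  have h7 : (((Ioc 0 M).filter (fun n => ¬ Squarefree n)).card : ℝ) ≤
      ((M / 4 : ℕ) : ℝ) + ((M / 9 : ℕ) : ℝ) + ∑ j ∈ Ico 2 (M + 2), ((M / (2 * j + 1) ^ 2 : ℕ) : ℝ) := by
    exact_mod_cast h1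
  push_cast at h5 h6
  linarith


lemma mertens_pow (k : ℕ) :
    ∑ p ∈ (Ioc 0 (2 ^ (k + 1))).filter Nat.Prime, (1 : ℝ) / p ≤ 1 + 4 * (harmonic k : ℝ) := by
  induction k with
  | zero =>
    have : (Ioc 0 (2 ^ (0 + 1))).filter Nat.Prime = {2} := by decide
    rw [this]; norm_num
  | succ k ih =>
    set A := (Ioc 0 (2 ^ (k + 1))).filter Nat.Prime with hA
    set B := (Ioc (2 ^ (k + 1)) (2 ^ (k + 1 + 1))).filter Nat.Prime with hB
    have hpow : (2 : ℕ) ^ (k + 1) ≤ 2 ^ (k + 1 + 1) := Nat.pow_le_pow_right (by norm_num) (by omega)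
    have hU : (Ioc 0 (2 ^ (k + 1 + 1))).filter Nat.Prime = A ∪ B := by
      rw [hA, hB, ← filter_union, Ioc_union_Ioc_eq_Ioc (by positivity) hpow]
    have hD : Disjoint A B := by
      apply disjoint_filter_filter
      rw [disjoint_left]
      intro x hx hy
      rw [mem_Ioc] at hx hy
      omega
    rw [hU, sum_union hD, harmonic_succ]
    push_cast
    have hx : (0 : ℝ) < 2 ^ (k + 1) := by positivity
    have hl2 : 0 < Real.log 2 := Real.log_pos (by norm_num)
    have hth := Chebyshev.theta_le_log4_mul_x (x := ((2 ^ (k + 1 + 1) : ℕ) : ℝ)) (by positivity)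
    have h4 : Real.log 4 = 2 * Real.log 2 := by
      rw [show (4:ℝ) = 2 ^ 2 by norm_num, Real.log_pow]; norm_num
    rw [Chebyshev.theta, Nat.floor_natCast, hU, h4] at hth
    have hBs : ∑ p ∈ B, Real.log p ≤ ∑ p ∈ A ∪ B, Real.log p :=
      sum_le_sum_of_subset_of_nonneg subset_union_right fun _ _ _ => Real.log_natCast_nonneg _
    have hBc : (B.card : ℝ) * ((k + 1) * Real.log 2) ≤ ∑ p ∈ B, Real.log p := by
      rw [← nsmul_eq_mul]
      apply card_nsmul_le_sum
      intro p hp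
      have h1 := (mem_Ioc.1 (mem_filter.1 hp).1).1
      have : Real.log ((2 : ℝ) ^ (k + 1)) ≤ Real.log p := by
        apply Real.log_le_log hx
        exact_mod_cast h1.le
      rw [Real.log_pow] at this
      exact_mod_cast this
    have hcard : (B.card : ℝ) * (k + 1) ≤ 4 * 2 ^ (k + 1) := by
      have : (B.card : ℝ) * (k + 1) * Real.log 2 ≤ 4 * 2 ^ (k + 1) * Real.log 2 := by
        have e : ((2 ^ (k + 1 + 1) : ℕ) : ℝ) = 2 * 2 ^ (k + 1) := by push_cast; ring
        rw [e] at hth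
        linarith
      exact le_of_mul_le_mul_right this hl2
    have hBsum : ∑ p ∈ B, (1 : ℝ) / p ≤ B.card * (1 / 2 ^ (k + 1)) := by
      rw [← nsmul_eq_mul]
      apply sum_le_card_nsmul
      intro p hp
      have h1 := (mem_Ioc.1 (mem_filter.1 hp).1).1
      apply one_div_le_one_div_of_le hx
      exact_mod_cast h1.le
    have : (B.card : ℝ) * (1 / 2 ^ (k + 1)) ≤ 4 * ((k : ℝ) + 1)⁻¹ := by
      rw [mul_one_div, ← div_eq_mul_inv, div_le_div_iff₀ hx (by positivity)]
      exact hcard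
    linarith

lemma mertens_le : ∀ᶠ N : ℕ in Filter.atTop,
    ∑ p ∈ (Ioc 0 N).filter Nat.Prime, (1 : ℝ) / p ≤ 5 * Real.log (Real.log N) := by
  have hL : Filter.Tendsto (fun N : ℕ => Real.log (Real.log N)) Filter.atTop Filter.atTop :=
    Real.tendsto_log_atTop.comp (Real.tendsto_log_atTop.comp tendsto_natCast_atTop_atTop)
  filter_upwards [hL.eventually_ge_atTop 13, Filter.eventually_ge_atTop 3] with N hN hN3
  set k := Nat.log 2 N with hk
  have hk1 : 1 ≤ k := Nat.log_pos (by norm_num) (by omega)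
  have h1 : N ≤ 2 ^ (k + 1) := (Nat.lt_pow_succ_log_self (by norm_num) N).le
  have h2 : ∑ p ∈ (Ioc 0 N).filter Nat.Prime, (1 : ℝ) / p ≤
      ∑ p ∈ (Ioc 0 (2 ^ (k + 1))).filter Nat.Prime, (1 : ℝ) / p := by
    apply sum_le_sum_of_subset_of_nonneg
    · exact filter_subset_filter _ (Ioc_subset_Ioc_right h1)
    · intros; positivity
  have h3 := mertens_pow k
  have h4 := harmonic_le_one_add_log k
  have hlogN : 0 < Real.log N := Real.log_pos (by exact_mod_cast (by omega : 1 < N))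
  have h5 : (k : ℝ) ≤ 2 * Real.log N := by
    have : ((2 : ℝ) ^ k) ≤ N := by exact_mod_cast Nat.pow_log_le_self 2 (by omega)
    have := Real.log_le_log (by positivity) this
    rw [Real.log_pow] at this
    have hl2 : (0.69 : ℝ) < Real.log 2 := by linarith [Real.log_two_gt_d9]
    have : (0:ℝ) ≤ k := by positivity
    nlinarith
  have h6 : Real.log k ≤ Real.log 2 + Real.log (Real.log N) := by
    rw [← Real.log_mul (by norm_num) hlogN.ne']
    exact Real.log_le_log (by exact_mod_cast hk1) h5
  have hl2' : Real.log 2 < (0.7 : ℝ) := by linarith [Real.log_two_lt_d9]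
  linarith

lemma double_sum (H : ℕ → ℕ → ℂ) (N : ℕ) :
    ∑ n ∈ Ioc 0 N, ∑ x ∈ n.divisorsAntidiagonal, H x.1 x.2 =
      ∑ d ∈ Ioc 0 N, ∑ m ∈ Ioc 0 (N / d), H d m := by
  rw [sum_sigma', sum_sigma']
  refine sum_bij' (fun x _ => ⟨x.2.1, x.2.2⟩) (fun y _ => ⟨y.1 * y.2, (y.1, y.2)⟩) ?_ ?_ ?_ ?_ ?_
  · rintro ⟨n, a, b⟩ h
    simp only [mem_sigma, mem_Ioc, Nat.mem_divisorsAntidiagonal] at h ⊢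
    obtain ⟨⟨h1, h2⟩, h3, h4⟩ := h
    have ha : 0 < a := Nat.pos_of_ne_zero (by rintro rfl; simp at h3; omega)
    have hb : 0 < b := Nat.pos_of_ne_zero (by rintro rfl; simp at h3; omega)
    refine ⟨⟨ha, ?_⟩, hb, ?_⟩
    · nlinarith
    · rw [Nat.le_div_iff_mul_le ha, mul_comm, h3]; exact h2
  · rintro ⟨a, b⟩ h
    simp only [mem_sigma, mem_Ioc, Nat.mem_divisorsAntidiagonal] at h ⊢
    obtain ⟨⟨h1, h2⟩, h3, h4⟩ := h
    rw [Nat.le_div_iff_mul_le h1, mul_comm] at h4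
    have : 0 < a * b := by positivity
    exact ⟨⟨this, h4⟩, trivial, this.ne'⟩
  · rintro ⟨n, a, b⟩ h
    simp only [mem_sigma, mem_Ioc, Nat.mem_divisorsAntidiagonal] at h ⊢
    obtain ⟨⟨h1, h2⟩, rfl, h4⟩ := h
    rfl
  · rintro ⟨a, b⟩ h
    rfl
  · rintro ⟨n, a, b⟩ h
    rfl


/-- Equidistribution of a multiplicative function that ignores the prime `q`. -/
lemma equid (h : ArithmeticFunction ℂ) (hm : h.IsMultiplicative) (z : ℂ) (q : ℕ) (hq : q.Prime)
    (hzq : z ^ q = 1) (hz : ∀ d, ¬ q ∣ d → z ^ d ≠ 1) (η : ℝ) (hη1 : η ≤ 1)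
    (hnorm : ∀ n, ‖h n‖ ≤ 1) (hp : ∀ p, p.Prime → ‖h p - 1‖ ≤ η) (hqk : ∀ k, h (q ^ k) = 1)
    (N : ℕ) :
    Real.log N * ‖∑ n ∈ Ioc 0 N, h n * z ^ n‖ ≤
      q * (101 * N * Real.exp (η * (∑ p ∈ (Ioc 0 N).filter Nat.Prime, (1 : ℝ) / p) + 8)) := by
  let g : ArithmeticFunction ℂ := h * (ArithmeticFunction.moebius : ArithmeticFunction ℂ)
  have hg : g * (ArithmeticFunction.zeta : ArithmeticFunction ℂ) = h := by
    simp only [g]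
    rw [mul_assoc, ArithmeticFunction.coe_moebius_mul_coe_zeta, mul_one]
  have hgm : g.IsMultiplicative := hm.mul ArithmeticFunction.isMultiplicative_moebius.intCast
  have hgpk : ∀ p, p.Prime → ∀ k, g (p ^ (k + 1)) = h (p ^ (k + 1)) - h (p ^ k) := by
    intro p hp k
    have key : ∀ k, h (p ^ k) = ∑ i ∈ range (k + 1), g (p ^ i) := by
      intro k
      conv_lhs => rw [← hg]
      rw [ArithmeticFunction.coe_mul_zeta_apply, Nat.sum_divisors_prime_pow hp]
    rw [key, key, sum_range_succ _ (k + 1)]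
    ring
  let F : ArithmeticFunction ℝ := ⟨fun n => ‖g n‖, by simp⟩
  have hFv : ∀ n, F n = ‖g n‖ := fun n => rfl
  have hF : F.IsMultiplicative := by
    refine ⟨by rw [hFv, hgm.map_one]; simp, ?_⟩
    intro m n hmn
    rw [hFv, hFv, hFv, hgm.map_mul_of_coprime hmn, norm_mul]
  have hF0 : ∀ n, 0 ≤ F n := fun n => by rw [hFv]; positivity
  have hFp : ∀ p, p.Prime → F p ≤ η := by
    intro p hpp
    have := hgpk p hpp 0
    simp only [zero_add, pow_one, pow_zero, hm.map_one] at this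
    rw [hFv, this]
    exact hp p hpp
  have hFpp : ∀ p, IsPrimePow p → F p ≤ 2 := by
    intro t ht
    rw [isPrimePow_nat_iff] at ht
    obtain ⟨p, k, hpp, hk, rfl⟩ := ht
    obtain ⟨k, rfl⟩ : ∃ j, k = j + 1 := ⟨k - 1, by omega⟩
    rw [hFv, hgpk p hpp]
    refine (norm_sub_le _ _).trans ?_
    linarith [hnorm (p ^ (k + 1)), hnorm (p ^ k)]
  have hgq : ∀ d, d ≠ 0 → q ∣ d → g d = 0 := by
    intro d hd0 hd
    rw [← Nat.ordProj_mul_ordCompl_eq_self d q, hgm.map_mul_of_coprime]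
    · have hk : d.factorization q ≠ 0 := (hq.factorization_pos_of_dvd hd0 hd).ne'
      obtain ⟨k, hk⟩ : ∃ j, d.factorization q = j + 1 := ⟨d.factorization q - 1, by omega⟩
      rw [hk, hgpk q hq, hqk, hqk]; simp
    · exact (Nat.coprime_ordCompl hq hd0).pow_left _
  have hsum : ∑ n ∈ Ioc 0 N, h n * z ^ n = ∑ d ∈ Ioc 0 N, g d * ∑ m ∈ Ioc 0 (N / d), (z ^ d) ^ m := by
    simp only [mul_sum]
    rw [← double_sum (fun d m => g d * (z ^ d) ^ m)]
    refine sum_congr rfl fun n hn => ?_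
    conv_lhs => rw [← hg]
    rw [ArithmeticFunction.mul_apply, sum_mul]
    refine sum_congr rfl fun x hx => ?_
    rw [Nat.mem_divisorsAntidiagonal] at hx
    have : x.2 ≠ 0 := by rintro h; rw [h] at hx; omega
    rw [← pow_mul, hx.1]
    simp [this]
  have hb : ‖∑ n ∈ Ioc 0 N, h n * z ^ n‖ ≤ q * ∑ d ∈ Ioc 0 N, F d := by
    rw [hsum, mul_sum]
    refine (norm_sum_le _ _).trans (sum_le_sum fun d hd => ?_)
    rw [norm_mul, hFv, mul_comm]
    by_cases hqd : q ∣ d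
    · rw [hgq d (by rw [mem_Ioc] at hd; omega) hqd]; simp
    · apply mul_le_mul_of_nonneg_right _ (norm_nonneg _)
      exact geom_bound _ q hq.pos (hz d hqd) (by rw [← pow_mul, mul_comm, pow_mul, hzq, one_pow]) _
  have h1 := sum_F_le F hF hF0 (fun p hp => (hFp p hp).trans hη1) hFpp N
  have h2 := euler_le F hF hF0 η hFp hFpp N
  calc _ ≤ Real.log N * (q * ∑ d ∈ Ioc 0 N, F d) :=
        mul_le_mul_of_nonneg_left hb (Real.log_natCast_nonneg _)
    _ = q * (Real.log N * ∑ d ∈ Ioc 0 N, F d) := by ring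
    _ ≤ _ := by
      refine mul_le_mul_of_nonneg_left (h1.trans ?_) (by positivity)
      exact mul_le_mul_of_nonneg_left h2 (by positivity)

lemma w_sqfree (w : ℕ → ℕ)
    (hw_add : ∀ m n : ℕ, 1 ≤ m → 1 ≤ n → Nat.Coprime m n → w (m * n) = w m + w n)
    (hw_prime : ∀ q : ℕ, Nat.Prime q → w q = 1) (n : ℕ) (hn : Squarefree n) :
    w n = n.primeFactors.card := by
  induction n using Nat.strong_induction_on with
  | _ n ih =>
    have hn0 : n ≠ 0 := hn.ne_zero
    by_cases h1 : n = 1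
    · subst h1
      have := hw_add 1 1 le_rfl le_rfl (by simp)
      simp at this ⊢
      omega
    · obtain ⟨m, hm⟩ := Nat.minFac_dvd n
      have hp := Nat.minFac_prime h1
      set p := n.minFac
      have hm0 : m ≠ 0 := by rintro rfl; simp at hm; exact hn0 hm
      have hc : Nat.Coprime p m := Nat.coprime_of_squarefree_mul (hm ▸ hn)
      have hsm : Squarefree m := hn.squarefree_of_dvd ⟨p, by rw [hm]; ring⟩
      have hlt : m < n := by
        rw [hm]; have := hp.two_le; have : 0 < m := by omega
        nlinarith
      have e1 := ih m hlt hsm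
      rw [hm, hw_add p m hp.one_le (by omega) hc, hw_prime p hp, e1, hc.primeFactors_mul,
        card_union_of_disjoint hc.disjoint_primeFactors, hp.primeFactors, card_singleton]

lemma mean_lower (w : ℕ → ℕ)
    (hw_add : ∀ m n : ℕ, 1 ≤ m → 1 ≤ n → Nat.Coprime m n → w (m * n) = w m + w n)
    (hw_prime : ∀ q : ℕ, Nat.Prime q → w q = 1) (θ : ℝ) (hθ : 0 ≤ θ) (z : ℂ)
    (hz : z = Complex.exp (Complex.I * θ)) (M : ℕ) :
    (M : ℝ) / 36 - θ * (M * √(3 * ∑ p ∈ (Ioc 0 M).filter Nat.Prime, (1 : ℝ) / p)) ≤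
      ‖∑ m ∈ Ioc 0 M, z ^ (w m)‖ := by
  set μ : ℝ := ∑ p ∈ (Ioc 0 M).filter Nat.Prime, (1 : ℝ) / p with hμ
  have hμ0 : 0 ≤ μ := sum_nonneg fun p _ => by positivity
  let k : ℕ → ℂ := fun m => Complex.exp (Complex.I * ((θ * ((w m : ℝ) - m.primeFactors.card) : ℝ) : ℂ))
  let c : ℂ := Complex.exp (Complex.I * ((θ * μ : ℝ) : ℂ))
  have nexp : ∀ x : ℝ, ‖Complex.exp (Complex.I * (x : ℂ))‖ = 1 := fun x => by
    rw [mul_comm]; exact Complex.norm_exp_ofReal_mul_I x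
  have hc : ‖c‖ = 1 := nexp _
  have hk : ∀ m, ‖k m‖ = 1 := fun m => nexp _
  have hdiff : ∀ m, ‖z ^ (w m) - k m * c‖ ≤ θ * |(m.primeFactors.card : ℝ) - μ| := by
    intro m
    have e : z ^ (w m) = k m * c *
        Complex.exp (Complex.I * ((θ * ((m.primeFactors.card : ℝ) - μ) : ℝ) : ℂ)) := by
      rw [hz, ← Complex.exp_nat_mul, ← Complex.exp_add, ← Complex.exp_add]
      congr 1; push_cast; ring
    rw [e, show ∀ a b : ℂ, a * b - a = a * (b - 1) from fun a b => by ring, norm_mul, norm_mul, hk, hc,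
      one_mul, one_mul]
    refine (Real.norm_exp_I_mul_ofReal_sub_one_le).trans ?_
    rw [Real.norm_eq_abs, abs_mul, abs_of_nonneg hθ]
  have habs : ∑ m ∈ Ioc 0 M, |(m.primeFactors.card : ℝ) - μ| ≤ M * √(3 * μ) := by
    have h1 := sq_sum_le_card_mul_sum_sq (s := Ioc 0 M)
      (f := fun m : ℕ => |(m.primeFactors.card : ℝ) - μ|)
    simp only [sq_abs, Nat.card_Ioc, Nat.sub_zero] at h1
    have h2 := tk M
    rw [← hμ] at h2
    apply abs_le_of_sq_le_sq' _ (by positivity) |>.2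
    rw [mul_pow, Real.sq_sqrt (by positivity)]
    have : (M : ℝ) * ∑ n ∈ Ioc 0 M, ((n.primeFactors.card:ℝ) - μ)^2 ≤ M * (3 * μ * M) := by gcongr
    nlinarith
  have hre : (M : ℝ) / 36 ≤ ‖∑ m ∈ Ioc 0 M, k m‖ := by
    refine le_trans ?_ ((le_abs_self _).trans (Complex.abs_re_le_norm _))
    rw [Complex.re_sum, ← sum_filter_add_sum_filter_not (Ioc 0 M) (fun n => Squarefree n)]
    have a1 : ∑ m ∈ (Ioc 0 M).filter (fun n => Squarefree n), (k m).re =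
        ((Ioc 0 M).filter (fun n => Squarefree n)).card := by
      rw [card_eq_sum_ones, Nat.cast_sum]
      refine sum_congr rfl fun m hm => ?_
      have := w_sqfree w hw_add hw_prime m (mem_filter.1 hm).2
      simp [k, this]
    have a2 : -(((Ioc 0 M).filter (fun n => ¬ Squarefree n)).card : ℝ) ≤
        ∑ m ∈ (Ioc 0 M).filter (fun n => ¬ Squarefree n), (k m).re := by
      rw [card_eq_sum_ones, Nat.cast_sum, ← sum_neg_distrib]
      refine sum_le_sum fun m _ => ?_
      have := (abs_le.1 ((Complex.abs_re_le_norm (k m)).trans_eq (hk m))).1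
      simpa using this
    have a3 : (((Ioc 0 M).filter (fun n => Squarefree n)).card : ℝ) +
      ((Ioc 0 M).filter (fun n => ¬ Squarefree n)).card = M := by
      rw [← Nat.cast_add, card_filter_add_card_filter_not]; simp
    have := nonsqfree M
    rw [a1]; linarith
  have hs : ‖∑ m ∈ Ioc 0 M, k m‖ = ‖∑ m ∈ Ioc 0 M, k m * c‖ := by
    rw [← sum_mul, norm_mul, hc, mul_one]
  have hd : ‖∑ m ∈ Ioc 0 M, k m * c‖ - ‖∑ m ∈ Ioc 0 M, z ^ (w m)‖ ≤ θ * (M * √(3 * μ)) := by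
    refine (norm_sub_norm_le _ _).trans ?_
    rw [norm_sub_rev, ← sum_sub_distrib]
    refine (norm_sum_le _ _).trans ((sum_le_sum fun m _ => hdiff m).trans ?_)
    rw [← mul_sum]; gcongr
  linarith

lemma second_lower (w : ℕ → ℕ)
    (hw_add : ∀ m n : ℕ, 1 ≤ m → 1 ≤ n → Nat.Coprime m n → w (m * n) = w m + w n)
    (hw_prime : ∀ q : ℕ, Nat.Prime q → w q = 1) (q : ℕ) (hq : q.Prime) (z : ℂ)
    (hz : ‖z‖ = 1) (N : ℕ) :
    ‖z - 1‖ * ‖∑ m ∈ Ioc 0 (N / q), z ^ (w m)‖ - 4 * ((N / q : ℕ) : ℝ) / q ≤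
      ‖∑ n ∈ Ioc 0 N, (z ^ (w n) - z ^ (w (n / q ^ n.factorization q)))‖ := by
  set f : ℕ → ℂ := fun n => z ^ (w n) - z ^ (w (n / q ^ n.factorization q)) with hf
  have hq0 := hq.pos
  have e1 : ∑ n ∈ Ioc 0 N, f n = ∑ m ∈ Ioc 0 (N / q), f (q * m) := by
    have : ∑ m ∈ Ioc 0 (N / q), f (q * m) = ∑ n ∈ (Ioc 0 (N / q)).image (fun m => q * m), f n := by
      rw [sum_image]
      intro a _ b _ hab
      exact Nat.eq_of_mul_eq_mul_left hq0 hab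
    rw [this]
    symm
    apply sum_subset
    · intro n hn
      simp only [mem_image, mem_Ioc] at hn ⊢
      obtain ⟨m, ⟨h1, h2⟩, rfl⟩ := hn
      refine ⟨by positivity, ?_⟩
      calc q * m ≤ q * (N / q) := by gcongr
        _ ≤ N := Nat.mul_div_le N q
    · intro n hn hn2
      have hnd : ¬ q ∣ n := by
        rintro ⟨m, rfl⟩
        apply hn2
        simp only [mem_image, mem_Ioc] at hn ⊢
        refine ⟨m, ⟨Nat.pos_of_mul_pos_left hn.1, ?_⟩, rfl⟩
        rw [Nat.le_div_iff_mul_le hq0, mul_comm]; exact hn.2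
      simp [hf, Nat.factorization_eq_zero_of_not_dvd hnd]
  have hn1 : ∀ k : ℕ, ‖z ^ k‖ = 1 := fun k => by rw [norm_pow, hz, one_pow]
  have hdiff : ∀ m ∈ Ioc 0 (N / q), ‖(z - 1) * z ^ (w m) - f (q * m)‖ ≤ if q ∣ m then 4 else 0 := by
    intro m hm
    rw [mem_Ioc] at hm
    split_ifs with hd
    · have := hn1 (w m)
      have := hn1 (w (q * m))
      have := hn1 (w (q * m / q ^ (q * m).factorization q))
      have h2 : ‖z - 1‖ ≤ 2 := by
        refine (norm_sub_le _ _).trans ?_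
        rw [hz, norm_one]; norm_num
      refine (norm_sub_le _ _).trans ?_
      rw [norm_mul, hn1, mul_one]
      have : ‖f (q * m)‖ ≤ 2 := by
        refine (norm_sub_le _ _).trans ?_
        rw [hn1, hn1]; norm_num
      linarith
    · have hc : Nat.Coprime q m := (Nat.Prime.coprime_iff_not_dvd hq).2 hd
      have hfac : (q * m).factorization q = 1 := by
        rw [Nat.factorization_mul hq.ne_zero (by omega)]
        simp [hq.factorization_self, Nat.factorization_eq_zero_of_not_dvd hd]
      have : f (q * m) = (z - 1) * z ^ (w m) := by
        simp only [hf]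
        rw [hfac, pow_one, Nat.mul_div_cancel_left _ hq0, hw_add q m hq.one_le (by omega) hc,
          hw_prime q hq]
        ring
      rw [this]; simp
  have hcard : ∑ m ∈ Ioc 0 (N / q), (if q ∣ m then (4 : ℝ) else 0) ≤ 4 * ((N / q : ℕ) : ℝ) / q := by
    rw [← sum_filter, sum_const, Nat.Ioc_filter_dvd_card_eq_div, nsmul_eq_mul]
    have := @Nat.cast_div_le ℝ _ _ _ (N / q) q
    rw [mul_div_assoc, mul_comm]; gcongr
  rw [e1]
  have h3 : ‖z - 1‖ * ‖∑ m ∈ Ioc 0 (N / q), z ^ (w m)‖ - ‖∑ m ∈ Ioc 0 (N / q), f (q * m)‖ ≤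
      ∑ m ∈ Ioc 0 (N / q), (if q ∣ m then (4 : ℝ) else 0) := by
    rw [← norm_mul, mul_sum]
    refine (norm_sub_norm_le _ _).trans ?_
    rw [← sum_sub_distrib]
    exact (norm_sum_le _ _).trans (sum_le_sum hdiff)
  linarith

lemma h_exists (w : ℕ → ℕ)
    (hw_add : ∀ m n : ℕ, 1 ≤ m → 1 ≤ n → Nat.Coprime m n → w (m * n) = w m + w n)
    (hw_prime : ∀ q : ℕ, Nat.Prime q → w q = 1) (q : ℕ) (hq : q.Prime) (z : ℂ)
    (hz : ‖z‖ = 1) :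
    ∃ h : ArithmeticFunction ℂ, h.IsMultiplicative ∧ (∀ n, ‖h n‖ ≤ 1) ∧
      (∀ p, p.Prime → ‖h p - 1‖ ≤ ‖z - 1‖) ∧ (∀ k, h (q ^ k) = 1) ∧
      ∀ n, n ≠ 0 → h n = z ^ (w (n / q ^ n.factorization q)) := by
  have w1 : w 1 = 0 := by
    have := hw_add 1 1 le_rfl le_rfl (by simp)
    simp at this
    omega
  let h : ArithmeticFunction ℂ :=
    ⟨fun n => if n = 0 then 0 else z ^ (w (n / q ^ n.factorization q)), by simp⟩
  have hh : ∀ n, n ≠ 0 → h n = z ^ (w (n / q ^ n.factorization q)) := by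
    intro n hn
    change (if n = 0 then 0 else z ^ (w (n / q ^ n.factorization q))) = _
    rw [if_neg hn]
  have hqk : ∀ k, h (q ^ k) = 1 := by
    intro k
    rw [hh _ (pow_ne_zero _ hq.ne_zero), hq.factorization_pow]
    simp [Nat.div_self (pow_pos hq.pos k), w1]
  refine ⟨h, ?_, ?_, ?_, hqk, hh⟩
  · rw [ArithmeticFunction.IsMultiplicative.iff_ne_zero]
    refine ⟨by simpa using hqk 0, ?_⟩
    intro m n hm hn hc
    rw [hh _ (mul_ne_zero hm hn), hh _ hm, hh _ hn, Nat.ordCompl_mul, hw_add, pow_add]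
    · exact Nat.ordCompl_pos q hm
    · exact Nat.ordCompl_pos q hn
    · exact Nat.Coprime.of_dvd (Nat.ordCompl_dvd m q) (Nat.ordCompl_dvd n q) hc
  · intro n
    by_cases hn : n = 0
    · simp [hn]
    · rw [hh _ hn, norm_pow, hz, one_pow]
  · intro p hp
    by_cases hpq : p = q
    · have := hqk 1
      rw [pow_one] at this
      rw [hpq, this]; simp
    · have hnd : ¬ q ∣ p := fun hd => hpq ((Nat.prime_dvd_prime_iff_eq hq hp).1 hd).symm
      rw [hh _ hp.ne_zero, Nat.factorization_eq_zero_of_not_dvd hnd, pow_zero, Nat.div_one,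
        hw_prime p hp, pow_one]

lemma core (w : ℕ → ℕ)
    (hw_add : ∀ m n : ℕ, 1 ≤ m → 1 ≤ n → Nat.Coprime m n → w (m * n) = w m + w n)
    (hw_prime : ∀ q : ℕ, Nat.Prime q → w q = 1) (q : ℕ) (hq : q.Prime) (hq2 : 1000 < q)
    (N : ℕ) (hN : 2 * q ≤ N) (θ : ℝ) (hθ : θ = 288 * Real.pi / q)
    (hμ : θ * √(3 * ∑ p ∈ (Ioc 0 N).filter Nat.Prime, (1 : ℝ) / p) ≤ 1 / 72) :
    ∃ E : ℝ, Real.log N * E ≤ q * (101 * N * Real.exp (θ *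
      (∑ p ∈ (Ioc 0 N).filter Nat.Prime, (1 : ℝ) / p) + 8)) ∧
      (N : ℝ) / q ^ 2 ≤ q + 2 * Xi w N + E := by
  have hqR : (1000 : ℝ) < q := by exact_mod_cast hq2
  have hq0 : (0 : ℝ) < q := by linarith
  have hpi := Real.pi_pos
  have hpi2 := Real.pi_lt_d2
  have hθ0 : 0 ≤ θ := by rw [hθ]; positivity
  have hθ1 : θ ≤ 1 := by
    rw [hθ, div_le_one hq0]; linarith
  set z : ℂ := Complex.exp (Complex.I * θ) with hz
  have hprim : IsPrimitiveRoot z q := by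
    have h1 := Complex.isPrimitiveRoot_exp q hq.ne_zero
    have h2 : Nat.Coprime 144 q := by
      rw [Nat.coprime_comm, Nat.Prime.coprime_iff_not_dvd hq]
      intro hd
      have := Nat.le_of_dvd (by norm_num) hd
      omega
    have h3 := h1.pow_of_coprime 144 h2
    have : z = Complex.exp (2 * Real.pi * Complex.I / q) ^ 144 := by
      rw [hz, ← Complex.exp_nat_mul, hθ]
      congr 1; push_cast; ring
    rwa [this]
  have hzn : ‖z‖ = 1 := by
    rw [hz, mul_comm]; exact Complex.norm_exp_ofReal_mul_I θ
  have hzq : z ^ q = 1 := hprim.pow_eq_one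
  have hzd : ∀ d, ¬ q ∣ d → z ^ d ≠ 1 := fun d hd h => hd ((hprim.pow_eq_one_iff_dvd d).1 h)
  have hz1 : z ≠ 1 := hprim.ne_one hq.one_lt
  have hup : ‖z - 1‖ ≤ θ := by
    refine (Real.norm_exp_I_mul_ofReal_sub_one_le).trans ?_
    rw [Real.norm_eq_abs, abs_of_nonneg hθ0]
  have hlow : 576 / (q : ℝ) ≤ ‖z - 1‖ := by
    rw [hz, Complex.norm_exp_I_mul_ofReal_sub_one, Real.norm_eq_abs]
    refine le_trans ?_ (le_abs_self _)
    have := Real.mul_le_sin (x := θ / 2) (by linarith) (by linarith [Real.pi_gt_three])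
    have e : 2 / Real.pi * (θ / 2) = 288 / q := by
      rw [hθ]; field_simp
    rw [e] at this
    have e2 : 576 / (q : ℝ) = 2 * (288 / q) := by ring
    rw [e2]; linarith
  obtain ⟨h, hm, hnorm, hp, hqk, hh⟩ := h_exists w hw_add hw_prime q hq z hzn
  refine ⟨‖∑ n ∈ Ioc 0 N, h n * z ^ n‖, equid h hm z q hq hzq hzd θ hθ1 hnorm
    (fun p hpp => (hp p hpp).trans hup) hqk N, ?_⟩
  have hsplit : ∑ n ∈ Ioc 0 N, (z ^ (w n) - z ^ (w (n / q ^ n.factorization q))) =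
      ∑ n ∈ Ioc 0 N, z ^ (n + w n) - ∑ n ∈ Ioc 0 N, h n * z ^ n := by
    rw [← sum_sub_distrib]
    refine sum_congr rfl fun n hn => ?_
    rw [mem_Ioc] at hn
    rw [hh n (by omega)]
    by_cases hd : q ∣ n
    · have : z ^ n = 1 := (hprim.pow_eq_one_iff_dvd n).2 hd
      rw [pow_add, this]; ring
    · rw [Nat.factorization_eq_zero_of_not_dvd hd, pow_zero, Nat.div_one, pow_add]; ring
  have h1 := second_lower w hw_add hw_prime q hq z hzn N
  rw [hsplit] at h1
  have h2 := norm_sub_le (∑ n ∈ Ioc 0 N, z ^ (n + w n)) (∑ n ∈ Ioc 0 N, h n * z ^ n)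
  have h3 := xi_ge w N z q hq.pos hz1 hzq
  set M := N / q with hM
  have hMN : M ≤ N := Nat.div_le_self _ _
  have h4 := mean_lower w hw_add hw_prime θ hθ0 z hz M
  have h5 : √(3 * ∑ p ∈ (Ioc 0 M).filter Nat.Prime, (1 : ℝ) / p) ≤
      √(3 * ∑ p ∈ (Ioc 0 N).filter Nat.Prime, (1 : ℝ) / p) := by
    apply Real.sqrt_le_sqrt
    refine mul_le_mul_of_nonneg_left ?_ (by norm_num)
    apply sum_le_sum_of_subset_of_nonneg
    · exact filter_subset_filter _ (Ioc_subset_Ioc_right hMN)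
    · intro i _ _; positivity
  have h6 : (M : ℝ) / 72 ≤ ‖∑ m ∈ Ioc 0 M, z ^ (w m)‖ := by
    have : θ * √(3 * ∑ p ∈ (Ioc 0 M).filter Nat.Prime, (1 : ℝ) / p) ≤ 1 / 72 :=
      (mul_le_mul_of_nonneg_left h5 hθ0).trans hμ
    have := mul_le_mul_of_nonneg_right this (Nat.cast_nonneg (α := ℝ) M)
    linarith
  have h7 : 576 / (q : ℝ) * ((M : ℝ) / 72) ≤ ‖z - 1‖ * ‖∑ m ∈ Ioc 0 M, z ^ (w m)‖ := by
    gcongr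
  have h8 : (N : ℝ) / q ≤ 2 * M := by
    have a : N < q * (M + 1) := by
      have := Nat.lt_mul_div_succ N hq.pos
      simpa [hM] using this
    have a' : (N : ℝ) < q * (M + 1) := by exact_mod_cast a
    have b : 2 ≤ M := by rw [hM, Nat.le_div_iff_mul_le hq.pos]; exact hN
    have b' : (2 : ℝ) ≤ M := by exact_mod_cast b
    rw [div_le_iff₀ hq0]
    nlinarith
  have h9 : (N : ℝ) / q ^ 2 ≤ 4 * M / q := by
    have : (N : ℝ) / q ^ 2 = N / q / q := by field_simp
    rw [this]
    gcongr
    linarith [Nat.cast_nonneg (α := ℝ) M]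
  have h10 : 576 / (q : ℝ) * ((M : ℝ) / 72) = 8 * M / q := by ring
  have h11 : 8 * (M : ℝ) / q = 4 * M / q + 4 * M / q := by ring
  linarith

lemma final_real (C : ℝ) (K : ℝ) (hC : 0 < C) : ∀ᶠ L : ℝ in Filter.atTop,
    K * (C * √L) ^ 3 ≤ Real.exp (L / 2) := by
  have h1 : Filter.Tendsto (fun L : ℝ => Real.exp L / L ^ 3) Filter.atTop Filter.atTop :=
    Real.tendsto_exp_div_pow_atTop 3
  have h2 := (h1.comp (Filter.tendsto_id.atTop_div_const (show (0 : ℝ) < 2 by norm_num))).eventually_ge_atTop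
    (|K| * C ^ 3 * 8)
  filter_upwards [h2, Filter.eventually_ge_atTop 1] with L hL h1
  simp only [Function.comp, id] at hL
  rw [le_div_iff₀ (by positivity)] at hL
  have hs : √L ≤ L := by rw [Real.sqrt_le_left (by linarith)]; nlinarith
  calc K * (C * √L) ^ 3 ≤ |K| * (C * L) ^ 3 := by
        gcongr; exact le_abs_self K
    _ = |K| * C ^ 3 * 8 * (L / 2) ^ 3 := by ring
    _ ≤ _ := hL

end XiHelpers

/-- There exists a constant `c > 0` such that for all sufficiently large `N`,
`Ξ(N) ≥ c·N / log log N`. -/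
theorem xi_lower_bound (w : ℕ → ℕ)
    (hw_add : ∀ m n : ℕ, 1 ≤ m → 1 ≤ n → Nat.Coprime m n → w (m * n) = w m + w n)
    (hw_prime : ∀ q : ℕ, Nat.Prime q → w q = 1) :
    ∃ c : ℝ, 0 < c ∧ ∀ᶠ N : ℕ in Filter.atTop,
      c * N / Real.log (Real.log N) ≤ (Xi w N : ℝ) := by
  refine ⟨1 / (36 * 10 ^ 12), by positivity, ?_⟩
  have hlog : Filter.Tendsto (fun N : ℕ => Real.log (N : ℝ)) Filter.atTop Filter.atTop :=
    Real.tendsto_log_atTop.comp tendsto_natCast_atTop_atTop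
  have hLL : Filter.Tendsto (fun N : ℕ => Real.log (Real.log (N : ℝ))) Filter.atTop Filter.atTop :=
    Real.tendsto_log_atTop.comp hlog
  have hfin := hLL.eventually (final_real (3 * 10 ^ 6) (404 * Real.exp 8) (by norm_num))
  filter_upwards [mertens_le, hfin, hLL.eventually_ge_atTop 1, hlog.eventually_gt_atTop 0]
    with N hmer hK hL1 hlog0
  set L : ℝ := Real.log (Real.log N) with hL
  set μ : ℝ := ∑ p ∈ (Finset.Ioc 0 N).filter Nat.Prime, (1 : ℝ) / p with hμd
  have hexpL : Real.exp L = Real.log N := Real.exp_log hlog0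
  have hs1 : 1 ≤ √L := Real.one_le_sqrt.2 hL1
  have hsq : √L * √L = L := Real.mul_self_sqrt (by linarith)
  obtain ⟨q, hq, hq1, hq2⟩ := Nat.exists_prime_lt_and_le_two_mul ⌈10 ^ 6 * √L⌉₊
    (by have : 0 < ⌈10 ^ 6 * √L⌉₊ := Nat.ceil_pos.2 (by positivity)
        omega)
  have hqlow : 10 ^ 6 * √L ≤ q := (Nat.le_ceil _).trans (by exact_mod_cast hq1.le)
  have hqup : (q : ℝ) ≤ 3 * 10 ^ 6 * √L := by
    have a := Nat.ceil_lt_add_one (a := 10 ^ 6 * √L) (by positivity)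
    have b : (q : ℝ) ≤ 2 * ⌈10 ^ 6 * √L⌉₊ := by exact_mod_cast hq2
    linarith
  have hq6 : (10 ^ 6 : ℝ) ≤ q := by linarith
  have hq0 : (0 : ℝ) < q := by linarith
  have he8 : 1 ≤ Real.exp 8 := Real.one_le_exp (by norm_num)
  have hcube : 404 * Real.exp 8 * (q : ℝ) ^ 3 ≤ Real.exp (L / 2) :=
    le_trans (by gcongr) hK
  have hN3 : 4 * (q : ℝ) ^ 3 ≤ N := by
    have h1 : Real.exp (L / 2) ≤ Real.exp L := Real.exp_le_exp.2 (by linarith)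
    have h2 : Real.log N ≤ N := Real.log_le_self (Nat.cast_nonneg N)
    have h3 : 4 * (q : ℝ) ^ 3 ≤ 404 * Real.exp 8 * (q : ℝ) ^ 3 := by gcongr; linarith
    linarith
  have hpi2 := Real.pi_lt_d2
  have hpi0 := Real.pi_pos
  obtain ⟨θ, hθ⟩ : ∃ θ : ℝ, θ = 288 * Real.pi / q := ⟨_, rfl⟩
  have hθ0 : 0 ≤ θ := by rw [hθ]; positivity
  have hθq : θ * q ≤ 910 := by
    rw [hθ, div_mul_cancel₀ _ hq0.ne']; linarith
  have hθs : θ * √L ≤ 910 / 10 ^ 6 := by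
    have : θ * (10 ^ 6 * √L) ≤ 910 := (mul_le_mul_of_nonneg_left hqlow hθ0).trans hθq
    rw [le_div_iff₀ (by norm_num)]; linarith
  have hsqrt : √(3 * μ) ≤ 4 * √L := by
    rw [Real.sqrt_le_left (by positivity), mul_pow, Real.sq_sqrt (by linarith)]
    linarith
  have hc1 : θ * √(3 * μ) ≤ 1 / 72 := by
    have : θ * √(3 * μ) ≤ θ * (4 * √L) := mul_le_mul_of_nonneg_left hsqrt hθ0
    linarith
  have hθμ : θ * μ ≤ L / 2 := by
    have h1 : θ ≤ 1 / 10 := by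
      have : θ * 1 ≤ θ * √L := mul_le_mul_of_nonneg_left hs1 hθ0
      linarith
    have h2 : θ * μ ≤ θ * (5 * L) := mul_le_mul_of_nonneg_left hmer hθ0
    have h3 : θ * (5 * L) ≤ 1 / 10 * (5 * L) := mul_le_mul_of_nonneg_right h1 (by linarith)
    linarith
  have hq1000 : 1000 < q := by
    have : (1000 : ℝ) < q := by linarith
    exact_mod_cast this
  have h2q : 2 * q ≤ N := by
    have : (2 : ℝ) * q ≤ N := by
      have : (q : ℝ) * 1 ≤ q * (q ^ 2) := by gcongr; nlinarith
      nlinarith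
    exact_mod_cast this
  obtain ⟨E, hE1, hE2⟩ := core w hw_add hw_prime q hq hq1000 N h2q θ hθ hc1
  rw [← hμd, ← hexpL] at hE1
  have hE : E ≤ N / (4 * q ^ 2) := by
    have hx : Real.exp L = Real.exp (L / 2) * Real.exp (L / 2) := by
      rw [← Real.exp_add]; congr 1; ring
    have h1 : Real.exp (θ * μ + 8) ≤ Real.exp (L / 2) * Real.exp 8 := by
      rw [← Real.exp_add]; exact Real.exp_le_exp.2 (by linarith)
    have h2 : Real.exp L * E ≤ q * (101 * N * (Real.exp (L / 2) * Real.exp 8)) :=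
      hE1.trans (by gcongr)
    have hp := Real.exp_pos (L / 2)
    have h3 : Real.exp (L / 2) * E ≤ q * (101 * N * Real.exp 8) := by
      rw [hx] at h2
      refine le_of_mul_le_mul_left ?_ hp
      linarith
    rw [le_div_iff₀ (by positivity)]
    refine le_of_mul_le_mul_left ?_ hp
    calc Real.exp (L / 2) * (E * (4 * (q : ℝ) ^ 2)) = Real.exp (L / 2) * E * (4 * q ^ 2) := by ring
      _ ≤ q * (101 * N * Real.exp 8) * (4 * q ^ 2) := by gcongr
      _ = 404 * Real.exp 8 * q ^ 3 * N := by ring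
      _ ≤ Real.exp (L / 2) * N := by gcongr
  have hqN : (q : ℝ) ≤ N / (4 * q ^ 2) := by
    rw [le_div_iff₀ (by positivity)]; linarith
  have hXi : (N : ℝ) / (4 * q ^ 2) ≤ Xi w N := by
    have : (N : ℝ) / q ^ 2 = 4 * (N / (4 * q ^ 2)) := by field_simp
    linarith
  refine le_trans ?_ hXi
  have hqq : 4 * (q : ℝ) ^ 2 ≤ 36 * 10 ^ 12 * L := by
    have : (q : ℝ) ^ 2 ≤ (3 * 10 ^ 6 * √L) ^ 2 := by gcongr
    rw [mul_pow, Real.sq_sqrt (by linarith)] at this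
    linarith
  calc 1 / (36 * 10 ^ 12) * (N : ℝ) / L = (N : ℝ) / (36 * 10 ^ 12 * L) := by field_simp
    _ ≤ (N : ℝ) / (4 * (q : ℝ) ^ 2) := by gcongr
end

section
/- Suppose there are constants C > 0 and 0 < ε < 1 such that w(n) ≤ C·n^ε for all n ≥ 1. Then G(N) ≫ Ξ(N), i.e. there is a constant c > 0 such that G(N) ≥ c·Ξ(N) for all sufficiently large N. -/
/-- `G w N` counts the pairs `(n, m)` with `1 ≤ n, m ≤ N`, `n ≠ m` and
`n + w n = m + w m`. -/
noncomputable def G (w : ℕ → ℕ) (N : ℕ) : ℕ :=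
  {q : ℕ × ℕ | q.1 ∈ Set.Icc 1 N ∧ q.2 ∈ Set.Icc 1 N ∧
    q.1 + w q.1 = q.2 + w q.2 ∧ q.1 ≠ q.2}.ncard


open Finset in
theorem collision_aux (f : ℕ → ℕ) (S : Finset ℕ) :
    S.card ≤ (S.image f).card +
      ((S ×ˢ S).filter (fun q => f q.1 = f q.2 ∧ q.1 ≠ q.2)).card := by
  classical
  have hg : ∀ y ∈ S.image f, ∃ x ∈ S, f x = y := by
    intro y hy; simpa using hy
  choose! g hgS hgf using hg
  set Rp := (S.image f).image g with hR
  have h1 : Rp.card ≤ (S.image f).card := card_image_le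
  have h2 : (S \ Rp).card ≤
      ((S ×ˢ S).filter (fun q => f q.1 = f q.2 ∧ q.1 ≠ q.2)).card := by
    apply card_le_card_of_injOn (fun n => (n, g (f n)))
    · intro n hn
      have hn' := mem_sdiff.1 (mem_coe.1 hn)
      have hfn : f n ∈ S.image f := mem_image_of_mem f hn'.1
      simp only [coe_filter, mem_product, Set.mem_ofPred_eq]
      refine ⟨⟨hn'.1, hgS _ hfn⟩, (hgf _ hfn).symm, ?_⟩
      intro h
      exact hn'.2 (by rw [h]; exact mem_image_of_mem g hfn)
    · intro a _ b _ h
      exact (Prod.mk.inj h).1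
  have h3 : S.card ≤ (S \ Rp).card + Rp.card := by
    have := le_card_sdiff Rp S
    omega
  omega

theorem G_add_ge (w : ℕ → ℕ) (N B : ℕ) (hB : ∀ n, 1 ≤ n → n ≤ N → w n ≤ B) :
    Xi w N ≤ G w N + B := by
  classical
  set f : ℕ → ℕ := fun n => n + w n with hf
  set S := Finset.Icc 1 N with hS
  set E := S.filter (fun k => ¬ ∃ n : ℕ, 1 ≤ n ∧ n + w n = k) with hE
  have hXi : Xi w N = E.card := by
    unfold Xi
    rw [← Set.ncard_coe_finset]
    congr 1
    ext k
    simp [hE, hS]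
  have hG : G w N = ((S ×ˢ S).filter (fun q => f q.1 = f q.2 ∧ q.1 ≠ q.2)).card := by
    unfold G
    rw [← Set.ncard_coe_finset]
    congr 1
    ext q
    simp [hf, hS]
    tauto
  have h1 := collision_aux f S
  have h2 : (S.image f).card ≤ ((S \ E) ∪ Finset.Icc (N+1) (N+B)).card := by
    apply Finset.card_le_card
    intro y hy
    obtain ⟨n, hn, rfl⟩ := Finset.mem_image.1 hy
    have hn' := Finset.mem_Icc.1 hn
    have := hB n hn'.1 hn'.2
    by_cases h : n + w n ≤ N
    · apply Finset.mem_union_left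
      rw [Finset.mem_sdiff]
      refine ⟨Finset.mem_Icc.2 ⟨by simp [hf]; omega, h⟩, ?_⟩
      simp only [hE, Finset.mem_filter, not_and, not_not]
      intro _
      exact ⟨n, hn'.1, rfl⟩
    · apply Finset.mem_union_right
      simp [hf]; omega
  have h3 := Finset.card_union_le (S \ E) (Finset.Icc (N+1) (N+B))
  have h4 : (S \ E).card + E.card = S.card :=
    Finset.card_sdiff_add_card_eq_card (Finset.filter_subset _ _)
  have h5 : (Finset.Icc (N+1) (N+B)).card = B := by simp
  rw [hXi, hG]
  omega

/-- Elements of `[1,N]` pairwise congruent mod `r`. -/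
theorem ap_card (S : Finset ℕ) (N r : ℕ) (_hr : 0 < r) (h1 : ∀ k ∈ S, k ≤ N)
    (h2 : ∀ k ∈ S, ∀ l ∈ S, k ≡ l [MOD r]) : S.card ≤ N / r + 1 := by
  have : S.card ≤ (Finset.range (N / r + 1)).card := by
    apply Finset.card_le_card_of_injOn (fun k => k / r)
    · intro k hk
      simp only [Finset.coe_range, Set.mem_Iio]
      exact Nat.lt_succ_of_le (Nat.div_le_div_right (h1 k hk))
    · intro k hk l hl h
      have h3 := h2 k hk l hl
      unfold Nat.ModEq at h3
      simp only at h
      rw [← Nat.div_add_mod k r, ← Nat.div_add_mod l r, h, h3]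
  simpa using this

theorem ap_card_real (N Q a s c : ℕ) (hQ : 0 < Q) (hs : 0 < s) (S : Finset ℕ)
    (h1 : ∀ k ∈ S, k ≤ N) (h2 : ∀ k ∈ S, k ≡ a [MOD Q]) (h3 : ∀ k ∈ S, k ≡ c [MOD s]) :
    (S.card : ℝ) ≤ (N : ℝ) / Q * ((Nat.gcd Q s : ℝ) / s) + 1 := by
  have hl : 0 < Nat.lcm Q s := Nat.lcm_pos hQ hs
  have h := ap_card S N (Nat.lcm Q s) hl h1 (by
    intro k hk l hl
    have e1 : k ≡ l [MOD Q] := (h2 k hk).trans (h2 l hl).symm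
    have e2 : k ≡ l [MOD s] := (h3 k hk).trans (h3 l hl).symm
    rw [Nat.modEq_iff_dvd] at *
    have := Int.coe_lcm_dvd e1 e2
    simpa [Int.lcm] using this)
  have h' : (S.card : ℝ) ≤ ((N / Nat.lcm Q s : ℕ) : ℝ) + 1 := by exact_mod_cast h
  have h4 : ((N / Nat.lcm Q s : ℕ) : ℝ) ≤ (N : ℝ) / (Nat.lcm Q s : ℕ) := Nat.cast_div_le
  have h5 : (N : ℝ) / (Nat.lcm Q s : ℕ) = (N : ℝ) / Q * ((Nat.gcd Q s : ℝ) / s) := by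
    have e : ((Nat.gcd Q s : ℕ) : ℝ) * (Nat.lcm Q s : ℕ) = Q * s := by
      exact_mod_cast Nat.gcd_mul_lcm Q s
    have q1 : (Q : ℝ) ≠ 0 := by positivity
    have q2 : (s : ℝ) ≠ 0 := by positivity
    have q3 : ((Nat.lcm Q s : ℕ) : ℝ) ≠ 0 := by positivity
    field_simp
    linear_combination (-(N : ℝ)) * e
  linarith

theorem w_one (w : ℕ → ℕ)
    (hw_add : ∀ m n : ℕ, 1 ≤ m → 1 ≤ n → Nat.Coprime m n → w (m * n) = w m + w n) :
    w 1 = 0 := by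
  have := hw_add 1 1 le_rfl le_rfl (by simp)
  simp at this
  exact this

/-- Decomposition into a powerful part and a squarefree part. -/
theorem decomp (w : ℕ → ℕ)
    (hw_add : ∀ m n : ℕ, 1 ≤ m → 1 ≤ n → Nat.Coprime m n → w (m * n) = w m + w n)
    (hw_prime : ∀ q : ℕ, Nat.Prime q → w q = 1) (n : ℕ) (hn : 0 < n) :
    ∃ x y m : ℕ, 0 < x ∧ 0 < y ∧ 0 < m ∧ n = x ^ 2 * y ^ 3 * m ∧
      (∀ p, p.Prime → p ∣ n → ¬ p ^ 2 ∣ n → p ∣ m) ∧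
      w n = w (x ^ 2 * y ^ 3) + m.primeFactors.card := by
  have h1 := w_one w hw_add
  revert hn
  induction n using Nat.recOnPosPrimePosCoprime with
  | zero => intro h; omega
  | one => intro _; exact ⟨1, 1, 1, by simp [h1]⟩
  | prime_pow p e hp he =>
    intro _
    rcases Nat.lt_or_ge 1 e with h | h
    · have key : ∃ x y : ℕ, 0 < x ∧ 0 < y ∧ p ^ e = x ^ 2 * y ^ 3 := by
        rcases Nat.even_or_odd' e with ⟨c, hc | hc⟩
        · exact ⟨p ^ c, 1, pow_pos hp.pos _, one_pos, by rw [hc]; ring⟩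
        · refine ⟨p ^ (c - 1), p, pow_pos hp.pos _, hp.pos, ?_⟩
          rw [← pow_mul, ← pow_add]
          congr 1; omega
      obtain ⟨x, y, hx, hy, hxy⟩ := key
      refine ⟨x, y, 1, hx, hy, one_pos, by simpa using hxy, ?_, by simp [← hxy]⟩
      intro q hq hqd hq2
      exfalso
      have : q = p := (Nat.prime_dvd_prime_iff_eq hq hp).1 (hq.dvd_of_dvd_pow hqd)
      subst this
      exact hq2 (pow_dvd_pow q h)
    · have : e = 1 := by omega
      subst this
      refine ⟨1, 1, p, one_pos, one_pos, hp.pos, by simp, ?_, ?_⟩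
      · intro q hq hqd _; simpa using hqd
      · simp [h1, hw_prime p hp, hp.primeFactors]
  | coprime a b ha hb hab iha ihb =>
    intro _
    obtain ⟨x, y, m, hx, hy, hm, e, hp, hw⟩ := iha (by omega)
    obtain ⟨x', y', m', hx', hy', hm', e', hp', hw'⟩ := ihb (by omega)
    have hmm : Nat.Coprime m m' :=
      Nat.Coprime.of_dvd (e ▸ Dvd.intro_left _ rfl) (e' ▸ Dvd.intro_left _ rfl) hab
    have hss : Nat.Coprime (x ^ 2 * y ^ 3) (x' ^ 2 * y' ^ 3) :=
      Nat.Coprime.of_dvd (e ▸ Dvd.intro _ rfl) (e' ▸ Dvd.intro _ rfl) hab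
    refine ⟨x * x', y * y', m * m', by positivity, by positivity, by positivity, ?_, ?_, ?_⟩
    · rw [e, e']; ring
    · intro p hpp hd hd2
      rcases hpp.dvd_mul.1 hd with h | h
      · exact Dvd.dvd.mul_right (hp p hpp h (fun h' => hd2 (h'.mul_right _))) _
      · exact Dvd.dvd.mul_left (hp' p hpp h (fun h' => hd2 (h'.mul_left _))) _
    · rw [hw_add a b (by omega) (by omega) hab, hw, hw', hmm.primeFactors_mul,
        Finset.card_union_of_disjoint hmm.disjoint_primeFactors]
      have : (x * x') ^ 2 * (y * y') ^ 3 = (x ^ 2 * y ^ 3) * (x' ^ 2 * y' ^ 3) := by ring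
      rw [this, hw_add _ _ (Nat.pos_of_ne_zero (by positivity))
        (Nat.pos_of_ne_zero (by positivity)) hss]
      ring


theorem sum_inv_sq_Icc (R M : ℕ) (hR : 1 ≤ R) :
    ∑ x ∈ Finset.Icc R M, ((x : ℝ) ^ 2)⁻¹ ≤ 2 / R := by
  have h := sum_Ioo_inv_sq_le (α := ℝ) (R - 1) (M + 1)
  have e : Finset.Ioo (R - 1) (M + 1) = Finset.Icc R M := by
    ext x; simp; omega
  rw [e] at h
  have : ((R - 1 : ℕ) : ℝ) + 1 = R := by
    rw [Nat.cast_sub hR]; simp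
  rwa [this] at h

theorem sum_dvd_inv_sq (d M : ℕ) (hd : 1 ≤ d) :
    ∑ x ∈ Finset.Icc 1 M, (if d ∣ x then (d : ℝ) * ((x : ℝ) ^ 2)⁻¹ else 0) ≤ 2 / d := by
  rw [← Finset.sum_filter]
  have hsub : (Finset.Icc 1 M).filter (fun x => d ∣ x) ⊆
      (Finset.Icc 1 M).image (fun e => d * e) := by
    intro x hx
    simp only [Finset.mem_filter, Finset.mem_Icc] at hx
    obtain ⟨e, rfl⟩ := hx.2
    refine Finset.mem_image.2 ⟨e, Finset.mem_Icc.2 ⟨?_, ?_⟩, rfl⟩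
    · rcases Nat.eq_zero_or_pos e with h | h
      · subst h; omega
      · exact h
    · exact (Nat.le_mul_of_pos_left e hd).trans hx.1.2
  have hd' : (0 : ℝ) < d := by exact_mod_cast hd
  calc ∑ x ∈ (Finset.Icc 1 M).filter (fun x => d ∣ x), (d : ℝ) * ((x : ℝ) ^ 2)⁻¹
      ≤ ∑ x ∈ (Finset.Icc 1 M).image (fun e => d * e), (d : ℝ) * ((x : ℝ) ^ 2)⁻¹ := by
        apply Finset.sum_le_sum_of_subset_of_nonneg hsub
        intros; positivity
    _ = ∑ e ∈ Finset.Icc 1 M, (d : ℝ) * (((d * e : ℕ) : ℝ) ^ 2)⁻¹ := by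
        rw [Finset.sum_image]
        intro a _ b _ h
        exact Nat.eq_of_mul_eq_mul_left hd h
    _ = (1 / d) * ∑ e ∈ Finset.Icc 1 M, ((e : ℝ) ^ 2)⁻¹ := by
        rw [Finset.mul_sum]
        apply Finset.sum_congr rfl
        intro e _
        push_cast
        rw [mul_pow, mul_inv]
        field_simp
    _ ≤ (1 / d) * 2 := by
        have := sum_inv_sq_Icc 1 M le_rfl
        gcongr
        simpa using this
    _ = 2 / d := by ring

theorem gcd_sum (Q P R M : ℕ) (hQ : 0 < Q) (hR : 1 ≤ R)
    (hP : ∀ d, d ∣ Q → d ≠ 1 → P ≤ d) (hRP : R * Q.divisors.card ≤ P) :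
    ∑ x ∈ Finset.Icc R M, (Nat.gcd Q x : ℝ) * ((x : ℝ) ^ 2)⁻¹ ≤ 4 / R := by
  have hR' : (0 : ℝ) < R := by exact_mod_cast hR
  have hcard : 0 < Q.divisors.card := Finset.card_pos.2 ⟨1, by simp; omega⟩
  have hP0 : 0 < P := lt_of_lt_of_le (Nat.mul_pos hR hcard) hRP
  have hP0' : (0 : ℝ) < P := by exact_mod_cast hP0
  have pt : ∀ x ∈ Finset.Icc R M, (Nat.gcd Q x : ℝ) * ((x : ℝ) ^ 2)⁻¹ ≤
      ((x : ℝ) ^ 2)⁻¹ + ∑ d ∈ Q.divisors.erase 1,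
        (if d ∣ x then (d : ℝ) * ((x : ℝ) ^ 2)⁻¹ else 0) := by
    intro x _
    have nn : ∀ d ∈ Q.divisors.erase 1,
        (0 : ℝ) ≤ (if d ∣ x then (d : ℝ) * ((x : ℝ) ^ 2)⁻¹ else 0) := by
      intro d _; split_ifs <;> positivity
    by_cases h : Nat.gcd Q x = 1
    · rw [h]
      have := Finset.sum_nonneg nn
      simp; simpa using this
    · have hm : Nat.gcd Q x ∈ Q.divisors.erase 1 := by
        simp [h, Nat.gcd_dvd_left]; omega
      have := Finset.single_le_sum nn hm
      rw [if_pos (Nat.gcd_dvd_right _ _)] at this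
      have h2 : (0 : ℝ) ≤ ((x : ℝ) ^ 2)⁻¹ := by positivity
      linarith
  refine (Finset.sum_le_sum pt).trans ?_
  rw [Finset.sum_add_distrib, Finset.sum_comm]
  have h1 := sum_inv_sq_Icc R M hR
  have h2 : ∑ d ∈ Q.divisors.erase 1, ∑ x ∈ Finset.Icc R M,
      (if d ∣ x then (d : ℝ) * ((x : ℝ) ^ 2)⁻¹ else 0) ≤
      ∑ d ∈ Q.divisors.erase 1, 2 / (P : ℝ) := by
    apply Finset.sum_le_sum
    intro d hd
    have hd' := Finset.mem_erase.1 hd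
    have hdQ := (Nat.mem_divisors.1 hd'.2).1
    have hPd := hP d hdQ hd'.1
    have hd1 : 1 ≤ d := by omega
    calc _ ≤ ∑ x ∈ Finset.Icc 1 M, (if d ∣ x then (d : ℝ) * ((x : ℝ) ^ 2)⁻¹ else 0) := by
          apply Finset.sum_le_sum_of_subset_of_nonneg
          · exact Finset.Icc_subset_Icc_left hR
          · intros; split_ifs <;> positivity
      _ ≤ 2 / d := sum_dvd_inv_sq d M hd1
      _ ≤ 2 / P := by
          have : (P : ℝ) ≤ d := by exact_mod_cast hPd
          gcongr
  rw [Finset.sum_const, nsmul_eq_mul] at h2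
  have h3 : ((Q.divisors.erase 1).card : ℝ) * (2 / P) ≤ 2 / R := by
    have e1 : ((Q.divisors.erase 1).card : ℝ) ≤ Q.divisors.card := by
      exact_mod_cast Finset.card_erase_le
    have e2 : (R : ℝ) * Q.divisors.card ≤ P := by exact_mod_cast hRP
    have e3 : (R : ℝ) * (Q.divisors.erase 1).card ≤ P := by nlinarith
    rw [mul_div_assoc', div_le_div_iff₀ hP0' hR']
    nlinarith
  have : (4 : ℝ) / R = 2 / R + 2 / R := by ring
  linarith

theorem gcd_pow_le (Q x y : ℕ) (hQ : Squarefree Q) :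
    Nat.gcd Q (x ^ 2 * y ^ 3) ≤ Nat.gcd Q x * Nat.gcd Q y := by
  have hQ0 : 0 < Q := Nat.pos_of_ne_zero hQ.ne_zero
  set g := Nat.gcd Q (x ^ 2 * y ^ 3) with hg
  have g1 : g ∣ Q := Nat.gcd_dvd_left _ _
  have g2 : g ∣ (x * y) ^ 3 := by
    refine (Nat.gcd_dvd_right Q _).trans ?_
    exact ⟨x, by ring⟩
  have g3 : g ∣ x * y := (hQ.squarefree_of_dvd g1).isRadical _ _ g2
  have g4 : g ∣ Nat.gcd Q x * Nat.gcd Q y :=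
    (Nat.dvd_gcd g1 g3).trans (Nat.gcd_mul_right_dvd_mul_gcd Q x y)
  exact Nat.le_of_dvd (Nat.mul_pos (Nat.gcd_pos_of_pos_left _ hQ0)
    (Nat.gcd_pos_of_pos_left _ hQ0)) g4

theorem harm (M : ℕ) : ∑ d ∈ Finset.Icc 1 M, ((d : ℝ))⁻¹ ≤ 1 + Real.log M := by
  have := harmonic_le_one_add_log M
  rw [harmonic_eq_sum_Icc] at this
  push_cast at this
  exact this

theorem card_pairs (M : ℕ) :
    ((((Finset.Icc 1 M) ×ˢ (Finset.Icc 1 M)).filter (fun q => q.1 * q.2 ≤ M)).card : ℝ) ≤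
      M * (1 + Real.log M) := by
  have e : ((((Finset.Icc 1 M) ×ˢ (Finset.Icc 1 M)).filter (fun q => q.1 * q.2 ≤ M)).card : ℝ)
      = ∑ x ∈ Finset.Icc 1 M, ∑ y ∈ Finset.Icc 1 M, (if x * y ≤ M then (1 : ℝ) else 0) := by
    rw [Finset.card_filter, Finset.sum_product]
    push_cast
    rfl
  rw [e]
  calc _ ≤ ∑ x ∈ Finset.Icc 1 M, (M : ℝ) * ((x : ℝ))⁻¹ := by
        apply Finset.sum_le_sum
        intro x hx
        have hx1 := (Finset.mem_Icc.1 hx).1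
        rw [← Finset.sum_filter, Finset.sum_const, nsmul_eq_mul, mul_one]
        have hc : ((Finset.Icc 1 M).filter (fun y => x * y ≤ M)).card ≤ M / x := by
          have : ((Finset.Icc 1 M).filter (fun y => x * y ≤ M)) ⊆ Finset.Icc 1 (M / x) := by
            intro y hy
            simp only [Finset.mem_filter, Finset.mem_Icc] at hy ⊢
            refine ⟨hy.1.1, (Nat.le_div_iff_mul_le hx1).2 (by rw [mul_comm]; exact hy.2)⟩
          simpa using Finset.card_le_card this
        calc _ ≤ ((M / x : ℕ) : ℝ) := by exact_mod_cast hc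
          _ ≤ (M : ℝ) / x := Nat.cast_div_le
          _ = _ := div_eq_mul_inv _ _
    _ ≤ _ := by
        rw [← Finset.mul_sum]
        exact mul_le_mul_of_nonneg_left (harm M) (by positivity)


def apSet (N Q a : ℕ) : Finset ℕ := (Finset.Icc 1 N).filter (fun k => k ≡ a [MOD Q])

theorem mem_apSet {N Q a k : ℕ} : k ∈ apSet N Q a ↔ (1 ≤ k ∧ k ≤ N) ∧ k ≡ a [MOD Q] := by
  simp [apSet]

theorem sum_pairs (Q P R M : ℕ) (hQ : Squarefree Q) (hR : 1 ≤ R)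
    (hP : ∀ d, d ∣ Q → d ≠ 1 → P ≤ d) (hRP : R * Q.divisors.card ≤ P) :
    ∑ q ∈ ((Finset.Icc 1 M) ×ˢ (Finset.Icc 1 M)).filter (fun q => R ≤ q.1 ∨ R ≤ q.2),
      ((Nat.gcd Q (q.1 ^ 2 * q.2 ^ 3) : ℕ) : ℝ) / ((q.1 ^ 2 * q.2 ^ 3 : ℕ) : ℝ) ≤ 32 / R := by
  have hQ0 : 0 < Q := Nat.pos_of_ne_zero hQ.ne_zero
  have hR' : (0 : ℝ) < R := by exact_mod_cast hR
  set f : ℕ → ℝ := fun x => (Nat.gcd Q x : ℝ) * ((x : ℝ) ^ 2)⁻¹ with hf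
  have fnn : ∀ x, 0 ≤ f x := fun x => by simp only [hf]; positivity
  have h1 : ∑ x ∈ Finset.Icc R M, f x ≤ 4 / R := gcd_sum Q P R M hQ0 hR hP hRP
  have h2 : ∑ x ∈ Finset.Icc 1 M, f x ≤ 4 := by
    have := gcd_sum Q P 1 M hQ0 le_rfl hP (le_trans (Nat.mul_le_mul_right _ hR) hRP)
    simpa using this
  have n1 : 0 ≤ ∑ x ∈ Finset.Icc R M, f x := Finset.sum_nonneg (fun x _ => fnn x)
  have n2 : 0 ≤ ∑ x ∈ Finset.Icc 1 M, f x := Finset.sum_nonneg (fun x _ => fnn x)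
  calc _ ≤ ∑ q ∈ ((Finset.Icc 1 M) ×ˢ (Finset.Icc 1 M)).filter (fun q => R ≤ q.1 ∨ R ≤ q.2),
        f q.1 * f q.2 := by
        apply Finset.sum_le_sum
        intro q hq
        simp only [Finset.mem_filter, Finset.mem_product, Finset.mem_Icc] at hq
        have hx : 0 < q.1 := hq.1.1.1
        have hy : 0 < q.2 := hq.1.2.1
        have hg : ((Nat.gcd Q (q.1 ^ 2 * q.2 ^ 3) : ℕ) : ℝ) ≤ Nat.gcd Q q.1 * Nat.gcd Q q.2 := by
          exact_mod_cast gcd_pow_le Q q.1 q.2 hQ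
        have hs : (q.1 : ℝ) ^ 2 * (q.2 : ℝ) ^ 2 ≤ ((q.1 ^ 2 * q.2 ^ 3 : ℕ) : ℝ) := by
          have : q.1 ^ 2 * q.2 ^ 2 ≤ q.1 ^ 2 * q.2 ^ 3 := by
            gcongr
            · norm_num
          exact_mod_cast this
        have hx' : (0 : ℝ) < q.1 := by exact_mod_cast hx
        have hy' : (0 : ℝ) < q.2 := by exact_mod_cast hy
        calc _ ≤ ((Nat.gcd Q q.1 : ℝ) * Nat.gcd Q q.2) / ((q.1 : ℝ) ^ 2 * (q.2 : ℝ) ^ 2) := by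
              gcongr
          _ = f q.1 * f q.2 := by simp only [hf]; field_simp
    _ ≤ ∑ q ∈ ((Finset.Icc R M) ×ˢ (Finset.Icc 1 M)) ∪ ((Finset.Icc 1 M) ×ˢ (Finset.Icc R M)),
        f q.1 * f q.2 := by
        apply Finset.sum_le_sum_of_subset_of_nonneg
        · intro q hq
          simp only [Finset.mem_filter, Finset.mem_product, Finset.mem_Icc, Finset.mem_union] at hq ⊢
          omega
        · intro q _ _; exact mul_nonneg (fnn _) (fnn _)
    _ ≤ ∑ q ∈ ((Finset.Icc R M) ×ˢ (Finset.Icc 1 M)), f q.1 * f q.2 +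
        ∑ q ∈ ((Finset.Icc 1 M) ×ˢ (Finset.Icc R M)), f q.1 * f q.2 := by
        rw [← Finset.sum_union_inter]
        have : 0 ≤ ∑ q ∈ ((Finset.Icc R M) ×ˢ (Finset.Icc 1 M)) ∩
          ((Finset.Icc 1 M) ×ˢ (Finset.Icc R M)), f q.1 * f q.2 :=
          Finset.sum_nonneg (fun q _ => mul_nonneg (fnn _) (fnn _))
        linarith
    _ = 2 * ((∑ x ∈ Finset.Icc R M, f x) * ∑ x ∈ Finset.Icc 1 M, f x) := by
        rw [Finset.sum_product, Finset.sum_product, ← Finset.sum_mul_sum, ← Finset.sum_mul_sum]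
        ring
    _ ≤ 2 * ((4 / R) * 4) := by gcongr
    _ = 32 / R := by ring

open Classical in
theorem bad_pow (w : ℕ → ℕ) (N Q P R a T : ℕ) (hQ : Squarefree Q) (hR : 1 ≤ R)
    (hP : ∀ d, d ∣ Q → d ≠ 1 → P ≤ d) (hRP : R * Q.divisors.card ≤ P) :
    (((apSet N Q a).filter (fun k => ∃ x y t n : ℕ, 0 < x ∧ 0 < y ∧ t ≤ T ∧ (R ≤ x ∨ R ≤ y) ∧
      0 < n ∧ x ^ 2 * y ^ 3 ∣ n ∧ k = n + w (x ^ 2 * y ^ 3) + t)).card : ℝ) ≤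
      (T + 1) * ((N : ℝ) / Q * (32 / R) + (Nat.sqrt N) * (1 + Real.log (Nat.sqrt N))) := by
  have hQ0 : 0 < Q := Nat.pos_of_ne_zero hQ.ne_zero
  set M := Nat.sqrt N with hM
  set I := ((Finset.Icc 1 M) ×ˢ (Finset.Icc 1 M)).filter
    (fun q => q.1 * q.2 ≤ M ∧ (R ≤ q.1 ∨ R ≤ q.2)) with hI
  set B : ℕ → ℕ × ℕ → Finset ℕ := fun t q => (apSet N Q a).filter
    (fun k => k ≡ w (q.1 ^ 2 * q.2 ^ 3) + t [MOD (q.1 ^ 2 * q.2 ^ 3)]) with hB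
  have hsub : ((apSet N Q a).filter (fun k => ∃ x y t n : ℕ, 0 < x ∧ 0 < y ∧ t ≤ T ∧
      (R ≤ x ∨ R ≤ y) ∧ 0 < n ∧ x ^ 2 * y ^ 3 ∣ n ∧ k = n + w (x ^ 2 * y ^ 3) + t)) ⊆
      (Finset.range (T + 1)).biUnion (fun t => I.biUnion (fun q => B t q)) := by
    intro k hk
    obtain ⟨hkK, x, y, t, n, hx, hy, ht, hRxy, hn, hdvd, hkn⟩ := Finset.mem_filter.1 hk
    have hkN := (mem_apSet.1 hkK).1.2
    have hxyn : x ^ 2 * y ^ 3 ≤ n := Nat.le_of_dvd hn hdvd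
    have hxyM : x * y ≤ M := by
      rw [hM, Nat.le_sqrt]
      have : x * y * (x * y) * 1 ≤ x * y * (x * y) * y := Nat.mul_le_mul_left _ hy
      have e : x * y * (x * y) * y = x ^ 2 * y ^ 3 := by ring
      omega
    have hxM : x ≤ M := (Nat.le_mul_of_pos_right x hy).trans hxyM
    have hyM : y ≤ M := (Nat.le_mul_of_pos_left y hx).trans hxyM
    simp only [Finset.mem_biUnion, Finset.mem_range]
    refine ⟨t, by omega, (x, y), ?_, ?_⟩
    · simp only [hI, Finset.mem_filter, Finset.mem_product, Finset.mem_Icc]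
      exact ⟨⟨⟨hx, hxM⟩, hy, hyM⟩, hxyM, hRxy⟩
    · simp only [hB, Finset.mem_filter]
      refine ⟨hkK, ?_⟩
      rw [hkn, add_assoc]
      have : n ≡ 0 [MOD (x ^ 2 * y ^ 3)] := (Nat.modEq_zero_iff_dvd).2 hdvd
      simpa using this.add_right (w (x ^ 2 * y ^ 3) + t)
  have hB1 : ∀ t, ∀ q ∈ I, ((B t q).card : ℝ) ≤ (N : ℝ) / Q *
      (((Nat.gcd Q (q.1 ^ 2 * q.2 ^ 3) : ℕ) : ℝ) / ((q.1 ^ 2 * q.2 ^ 3 : ℕ) : ℝ)) + 1 := by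
    intro t q hq
    simp only [hI, Finset.mem_filter, Finset.mem_product, Finset.mem_Icc] at hq
    have hx : 0 < q.1 := hq.1.1.1
    have hy : 0 < q.2 := hq.1.2.1
    apply ap_card_real N Q a (q.1 ^ 2 * q.2 ^ 3) (w (q.1 ^ 2 * q.2 ^ 3) + t) hQ0 (by positivity)
    · intro k hk; exact (mem_apSet.1 (Finset.mem_filter.1 hk).1).1.2
    · intro k hk; exact (mem_apSet.1 (Finset.mem_filter.1 hk).1).2
    · intro k hk; exact (Finset.mem_filter.1 hk).2
  have hI1 : ∀ t, ((I.biUnion (fun q => B t q)).card : ℝ) ≤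
      (N : ℝ) / Q * (32 / R) + M * (1 + Real.log M) := by
    intro t
    calc ((I.biUnion (fun q => B t q)).card : ℝ) ≤ ((∑ q ∈ I, (B t q).card : ℕ) : ℝ) := by
          exact_mod_cast Finset.card_biUnion_le
      _ = ∑ q ∈ I, ((B t q).card : ℝ) := by push_cast; rfl
      _ ≤ ∑ q ∈ I, ((N : ℝ) / Q *
      (((Nat.gcd Q (q.1 ^ 2 * q.2 ^ 3) : ℕ) : ℝ) / ((q.1 ^ 2 * q.2 ^ 3 : ℕ) : ℝ)) + 1) :=
          Finset.sum_le_sum (hB1 t)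
      _ = (N : ℝ) / Q * ∑ q ∈ I,
        (((Nat.gcd Q (q.1 ^ 2 * q.2 ^ 3) : ℕ) : ℝ) / ((q.1 ^ 2 * q.2 ^ 3 : ℕ) : ℝ)) + I.card := by
          rw [Finset.sum_add_distrib, Finset.mul_sum]; simp
      _ ≤ _ := by
          apply add_le_add
          · apply mul_le_mul_of_nonneg_left _ (by positivity)
            refine le_trans ?_ (sum_pairs Q P R M hQ hR hP hRP)
            apply Finset.sum_le_sum_of_subset_of_nonneg
            · intro q hq
              simp only [hI, Finset.mem_filter] at hq ⊢
              exact ⟨hq.1, hq.2.2⟩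
            · intros; positivity
          · refine le_trans ?_ (card_pairs M)
            have : I ⊆ ((Finset.Icc 1 M) ×ˢ (Finset.Icc 1 M)).filter (fun q => q.1 * q.2 ≤ M) := by
              intro q hq
              simp only [hI, Finset.mem_filter] at hq ⊢
              exact ⟨hq.1, hq.2.1⟩
            exact_mod_cast Finset.card_le_card this
  have hc := (Finset.card_le_card hsub).trans Finset.card_biUnion_le
  calc _ ≤ ((∑ t ∈ Finset.range (T + 1), (I.biUnion (fun q => B t q)).card : ℕ) : ℝ) := by
        exact_mod_cast hc
    _ = ∑ t ∈ Finset.range (T + 1), ((I.biUnion (fun q => B t q)).card : ℝ) := by push_cast; rfl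
    _ ≤ ∑ t ∈ Finset.range (T + 1), ((N : ℝ) / Q * (32 / R) + M * (1 + Real.log M)) :=
        Finset.sum_le_sum (fun t _ => hI1 t)
    _ = _ := by simp; ring

theorem small_divisors (n N T : ℕ) (hn : 0 < n) (hnN : n ≤ N) (hT : T ≤ n.primeFactors.card) :
    2 ^ T ≤ 2 * ((Finset.Icc 1 (Nat.sqrt N)).filter (fun d => d ∣ n)).card := by
  classical
  set D := (Finset.Icc 1 (Nat.sqrt N)).filter (fun d => d ∣ n) with hD
  have h1 : 2 ^ n.primeFactors.card ≤ n.divisors.card := by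
    rw [← Finset.card_powerset]
    apply Finset.card_le_card_of_injOn (fun s => ∏ p ∈ s, p)
    · intro s hs
      have hs' := Finset.mem_powerset.1 hs
      simp only [Finset.mem_coe, Nat.mem_divisors]
      refine ⟨(Finset.prod_dvd_prod_of_subset _ _ _ hs').trans (Nat.prod_primeFactors_dvd n),
        by omega⟩
    · intro s hs t ht h
      have hs' := Finset.mem_powerset.1 hs
      have ht' := Finset.mem_powerset.1 ht
      have e1 := Nat.primeFactors_prod (s := s) (fun p hp => Nat.prime_of_mem_primeFactors (hs' hp))
      have e2 := Nat.primeFactors_prod (s := t) (fun p hp => Nat.prime_of_mem_primeFactors (ht' hp))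
      simp only at h
      rw [← e1, ← e2, h]
  have h2 : n.divisors ⊆ D ∪ D.image (fun d => n / d) := by
    intro d hd
    have hdn := (Nat.mem_divisors.1 hd).1
    obtain ⟨e, he⟩ := hdn
    have hd0 : 0 < d := Nat.pos_of_ne_zero (by rintro rfl; simp at he; omega)
    have he0 : 0 < e := Nat.pos_of_ne_zero (by rintro rfl; simp at he; omega)
    rcases le_total d e with h | h
    · apply Finset.mem_union_left
      simp only [hD, Finset.mem_filter, Finset.mem_Icc, Nat.le_sqrt]
      exact ⟨⟨hd0, (Nat.mul_le_mul_left d h).trans (he ▸ hnN)⟩, ⟨e, he⟩⟩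
    · apply Finset.mem_union_right
      refine Finset.mem_image.2 ⟨e, ?_, ?_⟩
      · simp only [hD, Finset.mem_filter, Finset.mem_Icc, Nat.le_sqrt]
        exact ⟨⟨he0, (Nat.mul_le_mul_right e h).trans (he ▸ hnN)⟩, ⟨d, by rw [he, mul_comm]⟩⟩
      · rw [he]; exact Nat.mul_div_cancel _ he0
  have h3 := (Finset.card_le_card h2).trans (Finset.card_union_le _ _)
  have h4 : (D.image (fun d => n / d)).card ≤ D.card := Finset.card_image_le
  have h5 : 2 ^ T ≤ 2 ^ n.primeFactors.card := Nat.pow_le_pow_right (by norm_num) hT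
  omega

open Classical in
theorem bad_omega (N Q a j T : ℕ) (hQ : 0 < Q)
    (hc : ∀ n, n + j ≡ a [MOD Q] → Nat.Coprime Q n) :
    (((apSet N Q a).filter (fun k => ∃ n : ℕ, 0 < n ∧ k = n + j ∧
      T ≤ n.primeFactors.card)).card : ℝ) * 2 ^ T ≤
      2 * ((N : ℝ) / Q * (1 + Real.log (Nat.sqrt N)) + Nat.sqrt N) := by
  set M := Nat.sqrt N with hM
  set B := (apSet N Q a).filter (fun k => ∃ n : ℕ, 0 < n ∧ k = n + j ∧
      T ≤ n.primeFactors.card) with hB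
  set I := (Finset.Icc 1 M).filter (fun d => Nat.Coprime Q d) with hI
  have h1 : ∀ k ∈ B, 2 ^ T ≤ 2 * (I.filter (fun d => k ≡ j [MOD d])).card := by
    intro k hk
    obtain ⟨hkK, n, hn, hkn, hT⟩ := Finset.mem_filter.1 hk
    have hk' := mem_apSet.1 hkK
    have hco := hc n (hkn ▸ hk'.2)
    refine (small_divisors n N T hn (by omega) hT).trans ?_
    apply Nat.mul_le_mul_left
    apply Finset.card_le_card
    intro d hd
    simp only [hI, Finset.mem_filter] at hd ⊢
    refine ⟨⟨hd.1, hco.coprime_dvd_right hd.2⟩, ?_⟩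
    rw [hkn]
    simpa using ((Nat.modEq_zero_iff_dvd).2 hd.2).add_right j
  have h2 : B.card * 2 ^ T ≤ 2 * ∑ d ∈ I, (B.filter (fun k => k ≡ j [MOD d])).card := by
    calc B.card * 2 ^ T = ∑ k ∈ B, 2 ^ T := by simp
      _ ≤ ∑ k ∈ B, 2 * (I.filter (fun d => k ≡ j [MOD d])).card := Finset.sum_le_sum h1
      _ = 2 * ∑ k ∈ B, (I.filter (fun d => k ≡ j [MOD d])).card := by rw [Finset.mul_sum]
      _ = _ := by
        congr 1
        exact Finset.sum_card_bipartiteAbove_eq_sum_card_bipartiteBelow (fun k d => k ≡ j [MOD d])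
  have h3 : ∀ d ∈ I, ((B.filter (fun k => k ≡ j [MOD d])).card : ℝ) ≤
      (N : ℝ) / Q * (d : ℝ)⁻¹ + 1 := by
    intro d hd
    simp only [hI, Finset.mem_filter, Finset.mem_Icc] at hd
    have := ap_card_real N Q a d j hQ hd.1.1 (B.filter (fun k => k ≡ j [MOD d]))
      (fun k hk => (mem_apSet.1 (Finset.mem_filter.1 (Finset.mem_filter.1 hk).1).1).1.2)
      (fun k hk => (mem_apSet.1 (Finset.mem_filter.1 (Finset.mem_filter.1 hk).1).1).2)
      (fun k hk => (Finset.mem_filter.1 hk).2)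
    rw [hd.2] at this
    simpa using this
  have h4 : ∑ d ∈ I, ((B.filter (fun k => k ≡ j [MOD d])).card : ℝ) ≤
      (N : ℝ) / Q * (1 + Real.log M) + M := by
    calc _ ≤ ∑ d ∈ I, ((N : ℝ) / Q * (d : ℝ)⁻¹ + 1) := Finset.sum_le_sum h3
      _ ≤ ∑ d ∈ Finset.Icc 1 M, ((N : ℝ) / Q * (d : ℝ)⁻¹ + 1) := by
          apply Finset.sum_le_sum_of_subset_of_nonneg (Finset.filter_subset _ _)
          intros; positivity
      _ = (N : ℝ) / Q * ∑ d ∈ Finset.Icc 1 M, (d : ℝ)⁻¹ + M := by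
          rw [Finset.sum_add_distrib, Finset.mul_sum]; simp
      _ ≤ _ := by
          have := harm M
          gcongr
  have h5 : (B.card : ℝ) * 2 ^ T ≤
      2 * ∑ d ∈ I, ((B.filter (fun k => k ≡ j [MOD d])).card : ℝ) := by exact_mod_cast h2
  linarith


theorem apSet_card (N Q a : ℕ) (hQ : 0 < Q) : (N : ℝ) / Q - 1 ≤ ((apSet N Q a).card : ℝ) := by
  have h : N / Q ≤ (apSet N Q a).card := by
    obtain ⟨r, hr1, hr2, hr3⟩ : ∃ r, 1 ≤ r ∧ r ≤ Q ∧ r ≡ a [MOD Q] := by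
      rcases Nat.eq_zero_or_pos (a % Q) with h | h
      · refine ⟨Q, hQ, le_rfl, ?_⟩
        unfold Nat.ModEq; simp [h]
      · exact ⟨a % Q, h, (Nat.mod_lt _ hQ).le, Nat.mod_modEq _ _⟩
    have : (Finset.range (N / Q)).card ≤ (apSet N Q a).card := by
      apply Finset.card_le_card_of_injOn (fun i => Q * i + r)
      · intro i hi
        have hi' : i < N / Q := by simpa using hi
        refine mem_apSet.2 ⟨⟨le_trans hr1 (Nat.le_add_left _ _), ?_⟩, ?_⟩
        · show Q * i + r ≤ N
          have h1 : Q * (i + 1) ≤ Q * (N / Q) := Nat.mul_le_mul_left _ hi'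
          have h2 := Nat.mul_div_le N Q
          simp only [mul_add, mul_one] at h1
          omega
        · simp only [Nat.ModEq, Nat.mul_add_mod]
          exact hr3
      · intro i _ l _ h
        simp only at h
        exact Nat.eq_of_mul_eq_mul_left hQ (by omega)
    simpa using this
  have h2 : (N : ℝ) / Q < ((N / Q : ℕ) : ℝ) + 1 := by
    rw [← Nat.floor_div_eq_div (K := ℝ)]
    exact Nat.lt_floor_add_one _
  have h3 : ((N / Q : ℕ) : ℝ) ≤ (apSet N Q a).card := by exact_mod_cast h
  linarith

open Classical in
theorem main_param (w : ℕ → ℕ)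
    (hw_add : ∀ m n : ℕ, 1 ≤ m → 1 ≤ n → Nat.Coprime m n → w (m * n) = w m + w n)
    (hw_prime : ∀ q : ℕ, Nat.Prime q → w q = 1)
    (C : ℕ) (hC : ∀ n, 1 ≤ n → w n ≤ C * n)
    (J P T R0 R1 L X N : ℕ) (hNL : N < 2 ^ L)
    (hX : C * R1 ^ 5 + L ≤ X) (hJ : T + C * R0 ^ 5 ≤ J) (hXP : X < P)
    (hR0 : 1 ≤ R0) (hR1 : 1 ≤ R1)
    (p : ℕ → ℕ) (hp : ∀ i, (p i).Prime) (hpP : ∀ i, P < p i) (hpi : Function.Injective p)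
    (Q : ℕ) (hQdef : Q = ∏ i ∈ Finset.range (J ^ 2), p i)
    (hR0P : R0 * Q.divisors.card ≤ P) (hR1P : R1 * Q.divisors.card ≤ P) :
    (N : ℝ) / Q - 1 ≤ (Xi w N : ℝ) + (J : ℝ) ^ 2 * ((N : ℝ) / Q * (1 / P) + 1)
      + (X + 1) * (2 * ((N : ℝ) / Q * (1 + L) + Nat.sqrt N) / 2 ^ T)
      + (L + 1) * ((N : ℝ) / Q * (32 / R1) + Nat.sqrt N * (1 + L))
      + (T + 1) * ((N : ℝ) / Q * (32 / R0) + Nat.sqrt N * (1 + L)) := by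
  have hP0 : 0 < P := by omega
  have hP0' : (0 : ℝ) < P := by exact_mod_cast hP0
  have hcop : ∀ i l, i ≠ l → Nat.Coprime (p i) (p l) := fun i l h =>
    (Nat.coprime_primes (hp i) (hp l)).2 (fun h' => h (hpi h'))
  have hQsf : Squarefree Q := by
    rw [hQdef]
    apply Finset.squarefree_prod_of_pairwise_isCoprime
    · intro i _ l _ h
      exact Nat.coprime_iff_isRelPrime.1 (hcop i l h)
    · intro i _; exact (hp i).prime.squarefree
  have hQ0 : 0 < Q := Nat.pos_of_ne_zero hQsf.ne_zero
  have hpQ : ∀ i, i < J ^ 2 → p i ∣ Q := by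
    intro i hi
    rw [hQdef]; exact Finset.dvd_prod_of_mem p (Finset.mem_range.2 hi)
  have hPd : ∀ d, d ∣ Q → d ≠ 1 → P ≤ d := by
    intro d hd hd1
    obtain ⟨q, hq, hqd⟩ := Nat.exists_prime_and_dvd hd1
    have hqQ : q ∣ ∏ i ∈ Finset.range (J ^ 2), p i := hQdef ▸ hqd.trans hd
    obtain ⟨i, _, hi⟩ := (hq.prime.dvd_finsetProd_iff p).1 hqQ
    have : q = p i := (Nat.prime_dvd_prime_iff_eq hq (hp i)).1 hi
    have h1 := hpP i
    have h2 := Nat.le_of_dvd (Nat.pos_of_dvd_of_pos hd hQ0) hqd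
    omega
  obtain ⟨a, ha⟩ : ∃ a, ∀ i ∈ Finset.range (J ^ 2), a ≡ i / J [MOD p i] := by
    obtain ⟨a, ha⟩ := Nat.chineseRemainderOfFinset (fun i => i / J) p (Finset.range (J ^ 2))
      (fun i _ => (hp i).ne_zero) (fun i _ l _ h => hcop i l h)
    exact ⟨a, ha⟩
  set M := Nat.sqrt N with hM
  have hlog : Real.log M ≤ L := by
    rcases Nat.eq_zero_or_pos M with h | h
    · rw [h]; simp
    · have h1 : (M : ℝ) ≤ 2 ^ L := by
        have : M ≤ 2 ^ L := (Nat.sqrt_le_self N).trans hNL.le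
        exact_mod_cast this
      calc Real.log M ≤ Real.log (2 ^ L) := Real.log_le_log (by exact_mod_cast h) h1
        _ = L * Real.log 2 := Real.log_pow _ _
        _ ≤ L * 1 := by
            gcongr
            have := Real.log_two_lt_d9
            linarith
        _ = L := mul_one _
  set K := apSet N Q a with hK
  have hKp : ∀ k ∈ K, ∀ i, i < J ^ 2 → k ≡ i / J [MOD p i] := by
    intro k hk i hi
    exact ((mem_apSet.1 hk).2.of_dvd (hpQ i hi)).trans (ha i (Finset.mem_range.2 hi))
  set B1 := (Finset.range (J ^ 2)).biUnion
    (fun i => K.filter (fun k => k ≡ i / J [MOD (p i) ^ 2])) with hB1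
  set B2 := (Finset.range (X + 1)).biUnion
    (fun j => if J ≤ j then K.filter (fun k => ∃ n : ℕ, 0 < n ∧ k = n + j ∧
      T ≤ n.primeFactors.card) else ∅) with hB2
  set B3 := K.filter (fun k => ∃ x y t n : ℕ, 0 < x ∧ 0 < y ∧ t ≤ L ∧ (R1 ≤ x ∨ R1 ≤ y) ∧
      0 < n ∧ x ^ 2 * y ^ 3 ∣ n ∧ k = n + w (x ^ 2 * y ^ 3) + t) with hB3
  set B4 := K.filter (fun k => ∃ x y t n : ℕ, 0 < x ∧ 0 < y ∧ t ≤ T ∧ (R0 ≤ x ∨ R0 ≤ y) ∧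
      0 < n ∧ x ^ 2 * y ^ 3 ∣ n ∧ k = n + w (x ^ 2 * y ^ 3) + t) with hB4
  set E := (Finset.Icc 1 N).filter (fun k => ¬ ∃ n : ℕ, 1 ≤ n ∧ n + w n = k) with hE
  have hXi : Xi w N = E.card := by
    unfold Xi
    rw [← Set.ncard_coe_finset]
    congr 1
    ext k
    simp [hE]
  -- covering
  have hcover : K ⊆ E ∪ B1 ∪ B2 ∪ B3 ∪ B4 := by
    intro k hk
    have hk' := mem_apSet.1 hk
    by_contra hcon
    simp only [Finset.mem_union, not_or] at hcon
    obtain ⟨⟨⟨⟨nE, n1⟩, n2⟩, n3⟩, n4⟩ := hcon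
    have : ∃ n : ℕ, 1 ≤ n ∧ n + w n = k := by
      by_contra h
      exact nE (Finset.mem_filter.2 ⟨Finset.mem_Icc.2 hk'.1, h⟩)
    obtain ⟨n, hn, hnk⟩ := this
    obtain ⟨x, y, m, hx, hy, hm, hnxy, hpm, hwn⟩ := decomp w hw_add hw_prime n hn
    have hmn : m ∣ n := ⟨x ^ 2 * y ^ 3, by rw [hnxy]; ring⟩
    have hsn : x ^ 2 * y ^ 3 ∣ n := ⟨m, hnxy⟩
    have hs1 : 1 ≤ x ^ 2 * y ^ 3 := Nat.pos_of_ne_zero (by positivity)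
    set t := m.primeFactors.card with ht
    have htn : t ≤ n.primeFactors.card :=
      Finset.card_le_card (Nat.primeFactors_mono hmn (by omega))
    have htL : t ≤ L := by
      have h1 : 2 ^ t ≤ ∏ q ∈ m.primeFactors, q := by
        rw [ht]
        apply Finset.pow_card_le_prod
        intro q hq
        exact (Nat.prime_of_mem_primeFactors hq).two_le
      have h2 : ∏ q ∈ m.primeFactors, q ≤ m := Nat.le_of_dvd hm (Nat.prod_primeFactors_dvd m)
      have h3 : m ≤ n := Nat.le_of_dvd hn hmn
      have h4 : 2 ^ t < 2 ^ L := by omega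
      exact ((Nat.pow_lt_pow_iff_right (by norm_num)).1 h4).le
    by_cases hjJ : w n < J
    · -- many exact primes
      have hsub : (Finset.range J).image (fun u => p (w n * J + u)) ⊆ m.primeFactors := by
        intro q hq
        obtain ⟨u, hu, rfl⟩ := Finset.mem_image.1 hq
        have hu' := Finset.mem_range.1 hu
        set i := w n * J + u with hi
        have hiJ : i / J = w n := by
          rw [hi, mul_comm, Nat.mul_add_div (by omega), Nat.div_eq_of_lt hu']; simp
        have hi2 : i < J ^ 2 := by
          have : (w n + 1) * J ≤ J * J := Nat.mul_le_mul_right _ hjJ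
          rw [pow_two]; rw [add_mul] at this; omega
        have hki := hKp k hk i hi2
        rw [hiJ, ← hnk] at hki
        have hd : p i ∣ n := by
          have : n + w n ≡ 0 + w n [MOD p i] := by simpa using hki
          exact (Nat.modEq_zero_iff_dvd).1 (Nat.ModEq.add_right_cancel' _ this)
        have hd2 : ¬ (p i) ^ 2 ∣ n := by
          intro h
          apply n1
          refine Finset.mem_biUnion.2 ⟨i, Finset.mem_range.2 hi2, Finset.mem_filter.2 ⟨hk, ?_⟩⟩
          rw [hiJ, ← hnk]
          simpa using ((Nat.modEq_zero_iff_dvd).2 h).add_right (w n)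
        exact Nat.mem_primeFactors.2 ⟨hp i, hpm _ (hp i) hd hd2, by omega⟩
      have hcard := Finset.card_le_card hsub
      rw [Finset.card_image_of_injective _ (by
        intro u v h
        have := hpi h
        omega), Finset.card_range] at hcard
      omega
    · by_cases hbig : R1 ≤ x ∨ R1 ≤ y
      · exact n3 (Finset.mem_filter.2 ⟨hk, x, y, t, n, hx, hy, htL, hbig, hn, hsn, by omega⟩)
      · have bnd : ∀ R, ¬ (R ≤ x ∨ R ≤ y) → w (x ^ 2 * y ^ 3) ≤ C * R ^ 5 := by
          intro R hR
          have hx' : x ≤ R := by omega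
          have hy' : y ≤ R := by omega
          calc w (x ^ 2 * y ^ 3) ≤ C * (x ^ 2 * y ^ 3) := hC _ hs1
            _ ≤ C * (R ^ 2 * R ^ 3) := by gcongr
            _ = C * R ^ 5 := by ring
        have hjX : w n ≤ X := by
          have := bnd R1 hbig
          omega
        have htT : t < T := by
          by_contra h
          apply n2
          refine Finset.mem_biUnion.2 ⟨w n, Finset.mem_range.2 (by omega), ?_⟩
          rw [if_pos (by omega)]
          exact Finset.mem_filter.2 ⟨hk, n, hn, hnk.symm, by omega⟩
        by_cases hmid : R0 ≤ x ∨ R0 ≤ y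
        · exact n4 (Finset.mem_filter.2 ⟨hk, x, y, t, n, hx, hy, htT.le, hmid, hn, hsn, by omega⟩)
        · have := bnd R0 hmid
          omega
  have hc := Finset.card_le_card hcover
  have hc' : K.card ≤ E.card + B1.card + B2.card + B3.card + B4.card := by
    have e1 := Finset.card_union_le (E ∪ B1 ∪ B2 ∪ B3) B4
    have e2 := Finset.card_union_le (E ∪ B1 ∪ B2) B3
    have e3 := Finset.card_union_le (E ∪ B1) B2
    have e4 := Finset.card_union_le E B1
    omega
  have hc'' : (K.card : ℝ) ≤ E.card + B1.card + B2.card + B3.card + B4.card := by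
    exact_mod_cast hc'
  have hK1 := apSet_card N Q a hQ0
  have hNQ : (0 : ℝ) ≤ (N : ℝ) / Q := by positivity
  -- B1
  have b1 : (B1.card : ℝ) ≤ (J : ℝ) ^ 2 * ((N : ℝ) / Q * (1 / P) + 1) := by
    have h1 : ∀ i ∈ Finset.range (J ^ 2),
        ((K.filter (fun k => k ≡ i / J [MOD (p i) ^ 2])).card : ℝ) ≤
        (N : ℝ) / Q * (1 / P) + 1 := by
      intro i hi
      have hpos : 0 < p i := (hp i).pos
      have := ap_card_real N Q a ((p i) ^ 2) (i / J) hQ0 (by positivity)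
        (K.filter (fun k => k ≡ i / J [MOD (p i) ^ 2]))
        (fun k hk => (mem_apSet.1 (Finset.mem_filter.1 hk).1).1.2)
        (fun k hk => (mem_apSet.1 (Finset.mem_filter.1 hk).1).2)
        (fun k hk => (Finset.mem_filter.1 hk).2)
      refine this.trans ?_
      have hg : Nat.gcd Q ((p i) ^ 2) ≤ p i := by
        have h := gcd_pow_le Q (p i) 1 hQsf
        simp at h
        exact h.trans (Nat.gcd_le_right _ hpos)
      have hg' : ((Nat.gcd Q ((p i) ^ 2) : ℕ) : ℝ) ≤ p i := by exact_mod_cast hg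
      have hpos' : (0 : ℝ) < p i := by exact_mod_cast hpos
      have hPp : (P : ℝ) ≤ p i := by exact_mod_cast (hpP i).le
      have : ((Nat.gcd Q ((p i) ^ 2) : ℕ) : ℝ) / (((p i) ^ 2 : ℕ) : ℝ) ≤ 1 / P := by
        push_cast
        rw [div_le_div_iff₀ (by positivity) hP0']
        nlinarith
      gcongr
    calc (B1.card : ℝ) ≤ ((∑ i ∈ Finset.range (J ^ 2),
          (K.filter (fun k => k ≡ i / J [MOD (p i) ^ 2])).card : ℕ) : ℝ) := by
          exact_mod_cast Finset.card_biUnion_le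
      _ = ∑ i ∈ Finset.range (J ^ 2),
          ((K.filter (fun k => k ≡ i / J [MOD (p i) ^ 2])).card : ℝ) := by push_cast; rfl
      _ ≤ ∑ i ∈ Finset.range (J ^ 2), ((N : ℝ) / Q * (1 / P) + 1) := Finset.sum_le_sum h1
      _ = _ := by rw [Finset.sum_const, Finset.card_range, nsmul_eq_mul]; push_cast; ring
  have b2 : (B2.card : ℝ) ≤ (X + 1) * (2 * ((N : ℝ) / Q * (1 + L) + M) / 2 ^ T) := by
    have h1 : ∀ j ∈ Finset.range (X + 1),
        (((if J ≤ j then K.filter (fun k => ∃ n : ℕ, 0 < n ∧ k = n + j ∧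
          T ≤ n.primeFactors.card) else ∅ : Finset ℕ)).card : ℝ) ≤
        2 * ((N : ℝ) / Q * (1 + L) + M) / 2 ^ T := by
      intro j hj
      have hjX := Finset.mem_range.1 hj
      split_ifs with hjJ
      · rw [le_div_iff₀ (by positivity)]
        refine (bad_omega N Q a j T hQ0 ?_).trans ?_
        · intro n hn
          rw [hQdef]
          apply Nat.Coprime.prod_left
          intro i hi
          have hi' := Finset.mem_range.1 hi
          rw [(hp i).coprime_iff_not_dvd]
          intro hd
          have e1 : n + j ≡ i / J [MOD p i] := (hn.of_dvd (hpQ i hi')).trans (ha i hi)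
          have e2 : n + j ≡ j [MOD p i] := by
            simpa using ((Nat.modEq_zero_iff_dvd).2 hd).add_right j
          have e3 := e1.symm.trans e2
          have hij : i / J < J := by
            rw [pow_two] at hi'
            exact Nat.div_lt_of_lt_mul hi'
          have e4 := (Nat.modEq_iff_dvd' (by omega)).1 e3
          have key : ∀ v, v < J → p i ∣ j - v → False := by
            intro v hv hdv
            have h1 := Nat.le_of_dvd (by omega) hdv
            have h2 := hpP i
            omega
          exact key _ hij e4
        · gcongr
      · simp; positivity
    calc (B2.card : ℝ) ≤ ((∑ j ∈ Finset.range (X + 1),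
          ((if J ≤ j then K.filter (fun k => ∃ n : ℕ, 0 < n ∧ k = n + j ∧
          T ≤ n.primeFactors.card) else ∅ : Finset ℕ)).card : ℕ) : ℝ) := by
          exact_mod_cast Finset.card_biUnion_le
      _ = ∑ j ∈ Finset.range (X + 1),
          (((if J ≤ j then K.filter (fun k => ∃ n : ℕ, 0 < n ∧ k = n + j ∧
          T ≤ n.primeFactors.card) else ∅ : Finset ℕ)).card : ℝ) := by push_cast; rfl
      _ ≤ ∑ j ∈ Finset.range (X + 1), (2 * ((N : ℝ) / Q * (1 + L) + M) / 2 ^ T) :=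
          Finset.sum_le_sum h1
      _ = _ := by rw [Finset.sum_const, Finset.card_range, nsmul_eq_mul]; push_cast; ring
  have b3 : (B3.card : ℝ) ≤ (L + 1) * ((N : ℝ) / Q * (32 / R1) + M * (1 + L)) := by
    refine (bad_pow w N Q P R1 a L hQsf hR1 hPd hR1P).trans ?_
    gcongr
  have b4 : (B4.card : ℝ) ≤ (T + 1) * ((N : ℝ) / Q * (32 / R0) + M * (1 + L)) := by
    refine (bad_pow w N Q P R0 a T hQsf hR0 hPd hR0P).trans ?_
    gcongr
  rw [hXi]
  linarith


theorem ev_poly (K m : ℕ) : ∀ᶠ T : ℕ in Filter.atTop, K * (T + 1) ^ m ≤ 2 ^ T := by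
  have h := tendsto_pow_const_div_const_pow_of_one_lt m (r := (2 : ℝ)) (by norm_num)
  have h1 : ∀ᶠ n : ℕ in Filter.atTop, (n : ℝ) ^ m / 2 ^ n < 1 / (2 * (K + 1)) :=
    h.eventually (gt_mem_nhds (by positivity))
  have h2 := (Filter.tendsto_add_atTop_nat 1).eventually h1
  filter_upwards [h2] with T hT
  rw [div_lt_div_iff₀ (by positivity) (by positivity)] at hT
  have hp : (0 : ℝ) ≤ ((T + 1 : ℕ) : ℝ) ^ m := by positivity
  rw [pow_succ] at hT
  have : (K : ℝ) * ((T + 1 : ℕ) : ℝ) ^ m ≤ 2 ^ T := by nlinarith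
  exact_mod_cast this

theorem exists_scale (T0 N : ℕ) (hN : 2 ^ (T0 ^ 48) ≤ N) :
    ∃ T, T0 ≤ T ∧ 2 ^ (T ^ 48) ≤ N ∧ N < 2 ^ ((T + 1) ^ 48) := by
  have hex : ∃ S, N < 2 ^ (S ^ 48) := by
    refine ⟨N, lt_of_lt_of_le Nat.lt_two_pow_self (Nat.pow_le_pow_right (by norm_num) ?_)⟩
    exact Nat.le_self_pow (by norm_num) N
  have hs := Nat.find_spec hex
  have hm := fun m => Nat.find_min hex (m := m)
  set S := Nat.find hex
  have hS : T0 < S := by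
    by_contra h
    have : 2 ^ (S ^ 48) ≤ 2 ^ (T0 ^ 48) :=
      Nat.pow_le_pow_right (by norm_num) (Nat.pow_le_pow_left (by omega) _)
    omega
  refine ⟨S - 1, by omega, ?_, ?_⟩
  · have := hm (S - 1) (by omega)
    omega
  · rwa [Nat.sub_add_cancel (by omega)]

theorem exists_primes (P : ℕ) (hP : 0 < P) : ∃ p : ℕ → ℕ, (∀ i, (p i).Prime) ∧
    (∀ i, P < p i) ∧ Function.Injective p ∧ ∀ i, p i ≤ 2 ^ (i + 1) * P := by
  have h : ∀ i : ℕ, ∃ q, q.Prime ∧ 2 ^ i * P < q ∧ q ≤ 2 * (2 ^ i * P) := fun i =>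
    Nat.exists_prime_lt_and_le_two_mul (2 ^ i * P) (by positivity)
  choose p h1 h2 h3 using h
  refine ⟨p, h1, ?_, ?_, ?_⟩
  · intro i
    exact lt_of_le_of_lt (Nat.le_mul_of_pos_left P (by positivity)) (h2 i)
  · apply StrictMono.injective
    apply strictMono_nat_of_lt_succ
    intro i
    refine lt_of_le_of_lt (h3 i) ?_
    have := h2 (i + 1)
    rw [pow_succ] at this
    linarith
  · intro i
    have := h3 i
    rw [pow_succ]
    linarith

theorem card_divisors_prod (p : ℕ → ℕ) (hp : ∀ i, (p i).Prime) (n : ℕ) :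
    (∏ i ∈ Finset.range n, p i).divisors.card ≤ 2 ^ n := by
  induction n with
  | zero => simp
  | succ n ih =>
    rw [Finset.prod_range_succ, Nat.divisors_mul, pow_succ]
    refine Finset.card_mul_le.trans ?_
    have : (p n).divisors.card ≤ 2 := by
      rw [(hp n).divisors]
      exact Finset.card_le_two
    exact Nat.mul_le_mul ih this

theorem big_aux (J T : ℕ) (hTJ : T ≤ J) (hJ2 : 2 ≤ J) :
    2 * J ^ 5 + T + (2 * J ^ 5 + T) ≤ J ^ 8 := by
  have h5 : T ≤ J ^ 5 := hTJ.trans (Nat.le_self_pow (by norm_num) J)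
  have h8 : J ^ 8 = J ^ 3 * J ^ 5 := by ring
  have h3 : 2 ^ 3 ≤ J ^ 3 := Nat.pow_le_pow_left hJ2 3
  have h9 := Nat.mul_le_mul_right (J ^ 5) h3
  rw [← h8] at h9
  generalize J ^ 8 = a at *
  generalize J ^ 5 = b at *
  omega

theorem real_aux (J P T L X M : ℕ) (A x : ℝ) (hTL : T ≤ L)
    (hTP : 2 ^ (T + 2) ≤ P) (hPpos : (0 : ℝ) < P) (hA0 : 0 ≤ A) (hM1 : (1 : ℝ) ≤ M)
    (hAM : (2 : ℝ) ^ T * M ≤ A)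
    (e1 : 32 * (X + 1) * (1 + L) ≤ 2 ^ T)
    (e2 : 4 * (1 + J ^ 2 + 3 * (L + 1) ^ 2) ≤ 2 ^ T)
    (main : A - 1 ≤ x + (J : ℝ) ^ 2 * (A * (1 / P) + 1)
      + (X + 1) * (2 * (A * (1 + L) + M) / 2 ^ T)
      + (L + 1) * (A * (32 / ((512 * (L + 1) : ℕ) : ℝ)) + M * (1 + L))
      + (T + 1) * (A * (32 / ((512 * (T + 1) : ℕ) : ℝ)) + M * (1 + L))) :
    A ≤ 2 * x := by
  have f1 : (J : ℝ) ^ 2 * (A * (1 / P) + 1) ≤ A / 16 + J ^ 2 := by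
    have : 16 * J ^ 2 ≤ P := by
      rw [pow_add] at hTP
      omega
    have h : 16 * (J : ℝ) ^ 2 ≤ P := by exact_mod_cast this
    have h' : (J : ℝ) ^ 2 * (1 / P) ≤ 1 / 16 := by
      rw [mul_one_div, div_le_div_iff₀ hPpos (by norm_num)]; linarith
    nlinarith
  have f2 : ((X : ℝ) + 1) * (2 * (A * (1 + L) + M) / 2 ^ T) ≤ A / 16 + M := by
    have h : 32 * ((X : ℝ) + 1) * (1 + L) ≤ 2 ^ T := by exact_mod_cast e1
    rw [mul_div_assoc', div_le_iff₀ (by positivity)]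
    have hL0 : (0 : ℝ) ≤ L := by positivity
    have hX0 : (0 : ℝ) ≤ X := by positivity
    have h2 : 32 * ((X : ℝ) + 1) ≤ 2 ^ T := by nlinarith [mul_nonneg hX0 hL0]
    nlinarith
  have f3 : ((L : ℝ) + 1) * (A * (32 / ((512 * (L + 1) : ℕ) : ℝ)) + M * (1 + L)) ≤
      A / 16 + (L + 1) ^ 2 * M := by
    push_cast
    apply le_of_eq
    have : (L : ℝ) + 1 ≠ 0 := by positivity
    field_simp
    ring
  have f4 : ((T : ℝ) + 1) * (A * (32 / ((512 * (T + 1) : ℕ) : ℝ)) + M * (1 + L)) ≤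
      A / 16 + (L + 1) ^ 2 * M := by
    push_cast
    have h0 : (T : ℝ) + 1 ≠ 0 := by positivity
    have hh : ((T : ℝ) + 1) * (A * (32 / (512 * ((T : ℝ) + 1))) + M * (1 + L)) =
      A / 16 + (T + 1) * (L + 1) * M := by
      field_simp
      ring
    rw [hh, sq]
    have : (T : ℝ) ≤ L := by exact_mod_cast hTL
    gcongr
  have f5 : 4 * (1 + (J : ℝ) ^ 2 + 3 * ((L : ℝ) + 1) ^ 2) ≤ 2 ^ T := by exact_mod_cast e2
  have f6 : 4 * (1 + (J : ℝ) ^ 2 + 3 * ((L : ℝ) + 1) ^ 2) * M ≤ A :=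
    (mul_le_mul_of_nonneg_right f5 (by linarith)).trans hAM
  have f7 : 1 + (J : ℝ) ^ 2 ≤ (1 + (J : ℝ) ^ 2) * M := by nlinarith [sq_nonneg (J : ℝ)]
  have f8 : (M : ℝ) ≤ (L + 1) ^ 2 * M := by
    have : (0 : ℝ) ≤ L := by positivity
    nlinarith [mul_nonneg this (by linarith : (0 : ℝ) ≤ M), mul_nonneg (mul_nonneg this this) (by linarith : (0 : ℝ) ≤ M)]
  have f9 : 4 * (1 + (J : ℝ) ^ 2 + 3 * ((L : ℝ) + 1) ^ 2) * M =
      4 * ((1 + (J : ℝ) ^ 2) * M) + 12 * ((L + 1) ^ 2 * M) := by ring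
  linarith

/-- Many missed values. -/
theorem Xi_lower (w : ℕ → ℕ)
    (hw_add : ∀ m n : ℕ, 1 ≤ m → 1 ≤ n → Nat.Coprime m n → w (m * n) = w m + w n)
    (hw_prime : ∀ q : ℕ, Nat.Prime q → w q = 1)
    (C : ℕ) (hC : ∀ n, 1 ≤ n → w n ≤ C * n)
    (T N J L X : ℕ) (hTL : T ≤ L)
    (hXd : C * (512 * (L + 1)) ^ 5 + L ≤ X) (hT2 : 2 ≤ T)
    (hN1 : 2 ^ (J ^ 8) ≤ N) (hN2 : N < 2 ^ L)
    (e1 : 32 * (X + 1) * (1 + L) ≤ 2 ^ T)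
    (e2 : 4 * (1 + J ^ 2 + 3 * (L + 1) ^ 2) ≤ 2 ^ T)
    (e4 : T + C * (512 * (T + 1)) ^ 5 ≤ J) (e6 : 512 * (L + 1) ≤ 2 ^ T) :
    ∃ Q : ℕ, 0 < Q ∧ Q ≤ 2 ^ (2 * J ^ 5) ∧ (N : ℝ) / Q ≤ 2 * Xi w N := by
  set P := 2 ^ (J ^ 3) with hPd
  have hTJ : T ≤ J := by omega
  have hJ2 : 2 ≤ J := by omega
  obtain ⟨p, hp, hpP, hpi, hple⟩ := exists_primes P (by positivity)
  set Q := ∏ i ∈ Finset.range (J ^ 2), p i with hQ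
  have hQ0 : 0 < Q := Finset.prod_pos (fun i _ => (hp i).pos)
  have hcard : Q.divisors.card ≤ 2 ^ (J ^ 2) := card_divisors_prod p hp _
  have hQle : Q ≤ 2 ^ (2 * J ^ 5) := by
    have h1 : Q ≤ ∏ i ∈ Finset.range (J ^ 2), 2 ^ (J ^ 2) * P := by
      apply Finset.prod_le_prod' 
      intro i hi
      refine (hple i).trans ?_
      apply Nat.mul_le_mul_right
      exact Nat.pow_le_pow_right (by norm_num) (Finset.mem_range.1 hi)
    rw [Finset.prod_const, Finset.card_range, hPd, ← pow_add, ← pow_mul] at h1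
    refine h1.trans (Nat.pow_le_pow_right (by norm_num) ?_)
    have : J ^ 4 ≤ J ^ 5 := Nat.pow_le_pow_right (by omega) (by norm_num)
    calc (J ^ 2 + J ^ 3) * J ^ 2 = J ^ 4 + J ^ 5 := by ring
      _ ≤ 2 * J ^ 5 := by omega
  have hJJ : T + J ^ 2 ≤ J ^ 3 := by
    have : J ^ 3 = J * J ^ 2 := by ring
    nlinarith
  have hRP : ∀ R, R ≤ 2 ^ T → R * Q.divisors.card ≤ P := by
    intro R hR
    calc R * Q.divisors.card ≤ 2 ^ T * 2 ^ (J ^ 2) := Nat.mul_le_mul hR hcard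
      _ = 2 ^ (T + J ^ 2) := by rw [pow_add]
      _ ≤ P := Nat.pow_le_pow_right (by norm_num) hJJ
  have hTP : 2 ^ (T + 2) ≤ P := Nat.pow_le_pow_right (by norm_num) (by nlinarith)
  have hXT : X < 2 ^ T := by nlinarith [Nat.zero_le X, Nat.zero_le L, Nat.zero_le (X * L)]
  have hXP : X < P := by rw [pow_add] at hTP; omega
  have main := main_param w hw_add hw_prime C hC J P T (512 * (T + 1)) (512 * (L + 1)) L X N hN2
    (by omega) e4 hXP (by omega) (by omega) p hp hpP hpi Q hQ
    (hRP _ (by omega)) (hRP _ e6)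
  refine ⟨Q, hQ0, hQle, ?_⟩
  set M := Nat.sqrt N with hM
  -- real versions
  have hMN : M * M ≤ N := Nat.sqrt_le N
  have hMbig : 2 ^ (2 * J ^ 5 + T) ≤ M := by
    rw [hM, Nat.le_sqrt, ← pow_add]
    refine le_trans (Nat.pow_le_pow_right (by norm_num) ?_) hN1
    exact big_aux J T hTJ hJ2
  have hQM : Q * 2 ^ T ≤ M := by
    refine le_trans (Nat.mul_le_mul_right _ hQle) ?_
    rw [← pow_add]; exact hMbig
  set A : ℝ := (N : ℝ) / Q with hA
  have hQ0' : (0 : ℝ) < Q := by exact_mod_cast hQ0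
  have hAM : (2 : ℝ) ^ T * M ≤ A := by
    rw [hA, le_div_iff₀ hQ0']
    have h1 : (Q : ℝ) * 2 ^ T ≤ M := by exact_mod_cast hQM
    have h2 : (M : ℝ) * M ≤ N := by exact_mod_cast hMN
    have h3 : (0 : ℝ) ≤ M := by positivity
    nlinarith
  have hM1 : (1 : ℝ) ≤ M := by
    have : 1 ≤ M := le_trans Nat.one_le_two_pow hMbig
    exact_mod_cast this
  have hA0 : 0 ≤ A := by positivity
  have hPpos : (0 : ℝ) < P := by rw [hPd]; positivity
  exact real_aux J P T L X M A (Xi w N) hTL hTP hPpos hA0 hM1 hAM e1 e2 main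

theorem cond_e1 (C K U L X : ℕ) (hU : 1 ≤ U) (hL : L = U ^ 48)
    (hX : X = C * (512 * (L + 1)) ^ 5 + L) (hK : K = 1024 ^ 5) :
    32 * (X + 1) * (1 + L) ≤ (64 * (C * K + 2)) * U ^ 288 := by
  have h1 : 1 ≤ U ^ 48 := Nat.one_le_pow _ _ hU
  have h2 : L + 1 ≤ 2 * U ^ 48 := by omega
  have h3 : (512 * (L + 1)) ^ 5 ≤ K * U ^ 240 := by
    calc (512 * (L + 1)) ^ 5 ≤ (1024 * U ^ 48) ^ 5 := Nat.pow_le_pow_left (by omega) 5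
      _ = K * U ^ 240 := by rw [mul_pow, ← pow_mul, hK]
  have h4 : U ^ 48 ≤ U ^ 240 := Nat.pow_le_pow_right hU (by norm_num)
  have h5 : X + 1 ≤ (C * K + 2) * U ^ 240 := by
    calc X + 1 = C * (512 * (L + 1)) ^ 5 + (L + 1) := by rw [hX]; ring
      _ ≤ C * (K * U ^ 240) + 2 * U ^ 240 :=
        Nat.add_le_add (Nat.mul_le_mul_left _ h3) (by omega)
      _ = _ := by rw [← mul_assoc, ← add_mul]
  have h6 : 1 + L ≤ 2 * U ^ 48 := by omega
  calc 32 * (X + 1) * (1 + L) ≤ 32 * ((C * K + 2) * U ^ 240) * (2 * U ^ 48) :=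
        Nat.mul_le_mul (Nat.mul_le_mul_left _ h5) h6
    _ = (64 * (C * K + 2)) * (U ^ 240 * U ^ 48) := by
      generalize U ^ 240 = a
      generalize U ^ 48 = b
      ring
    _ = _ := by rw [← pow_add]

theorem cond_e2 (T J L : ℕ) (hJ : J = T ^ 6) (hL : L = (T + 1) ^ 48) :
    4 * (1 + J ^ 2 + 3 * (L + 1) ^ 2) ≤ 56 * (T + 1) ^ 96 := by
  have hU : 1 ≤ T + 1 := by omega
  have h1 : 1 ≤ (T + 1) ^ 48 := Nat.one_le_pow _ _ hU
  have h1' : 1 ≤ (T + 1) ^ 96 := Nat.one_le_pow _ _ hU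
  have h2 : (L + 1) ^ 2 ≤ 4 * (T + 1) ^ 96 := by
    calc (L + 1) ^ 2 ≤ (2 * (T + 1) ^ 48) ^ 2 := Nat.pow_le_pow_left (by omega) 2
      _ = _ := by rw [mul_pow, ← pow_mul]; norm_num
  have h3 : J ^ 2 ≤ (T + 1) ^ 96 := by
    rw [hJ, ← pow_mul]
    calc T ^ 12 ≤ (T + 1) ^ 12 := Nat.pow_le_pow_left (by omega) _
      _ ≤ _ := Nat.pow_le_pow_right hU (by norm_num)
  omega

theorem cond_e4 (C K T : ℕ) (hK : K = 1024 ^ 5) (hT : 1 + C * K ≤ T) :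
    T + C * (512 * (T + 1)) ^ 5 ≤ T ^ 6 := by
  have h1 : 1 ≤ T := by omega
  have h2 : (512 * (T + 1)) ^ 5 ≤ K * T ^ 5 := by
    rw [hK, ← mul_pow]
    exact Nat.pow_le_pow_left (by omega) 5
  calc T + C * (512 * (T + 1)) ^ 5 ≤ T ^ 5 + C * (K * T ^ 5) :=
        Nat.add_le_add (Nat.le_self_pow (by norm_num) T) (Nat.mul_le_mul_left _ h2)
    _ = (1 + C * K) * T ^ 5 := by ring
    _ ≤ T * T ^ 5 := Nat.mul_le_mul_right _ hT
    _ = T ^ 6 := by ring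

theorem final_real_s2 (C ε N Q x : ℝ) (J T : ℕ) (hε1 : ε < 1) (hC : 0 < C)
    (hTJ : T ≤ J) (hJ1 : 1 ≤ J) (he5 : 3 ≤ (1 - ε) * J) (he3 : 4 * C ≤ 2 ^ T)
    (hN : (2 : ℝ) ^ (J ^ 8) ≤ N) (hQ0 : 0 < Q) (hQ : Q ≤ 2 ^ (2 * J ^ 5))
    (hx : N / Q ≤ 2 * x) : 2 * (C * N ^ ε) ≤ x := by
  have hN0 : 0 < N := lt_of_lt_of_le (by positivity) hN
  have h1 : (2 : ℝ) ^ (2 * J ^ 5 + T) ≤ N ^ (1 - ε) := by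
    calc (2 : ℝ) ^ (2 * J ^ 5 + T) = (2 : ℝ) ^ (((2 * J ^ 5 + T : ℕ)) : ℝ) := by
          rw [Real.rpow_natCast]
      _ ≤ (2 : ℝ) ^ (((J ^ 8 : ℕ) : ℝ) * (1 - ε)) := by
          apply Real.rpow_le_rpow_of_exponent_le (by norm_num)
          push_cast
          have a1 : (1 : ℝ) ≤ J := by exact_mod_cast hJ1
          have a2 : (T : ℝ) ≤ J ^ 5 := by
            exact_mod_cast hTJ.trans (Nat.le_self_pow (by norm_num) J)
          have a3 : (J : ℝ) ^ 5 ≤ J ^ 7 := pow_le_pow_right₀ a1 (by norm_num)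
          have a4 : (J : ℝ) ^ 8 * (1 - ε) = ((1 - ε) * J) * J ^ 7 := by ring
          have a5 := mul_le_mul_of_nonneg_right he5 (by positivity : (0 : ℝ) ≤ J ^ 7)
          rw [a4]
          linarith
      _ = ((2 : ℝ) ^ (J ^ 8)) ^ (1 - ε) := by
          rw [Real.rpow_mul (by norm_num), Real.rpow_natCast]
      _ ≤ N ^ (1 - ε) := Real.rpow_le_rpow (by positivity) hN (by linarith)
  have h2 : N ^ (1 - ε) * N ^ ε = N := by
    rw [← Real.rpow_add hN0]; simp
  have h3 : Q * (4 * C) ≤ N ^ (1 - ε) := by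
    refine le_trans ?_ h1
    rw [pow_add]
    exact mul_le_mul hQ he3 (by positivity) (by positivity)
  have hNe : 0 ≤ N ^ ε := Real.rpow_nonneg hN0.le _
  have h4 : 4 * (C * N ^ ε) ≤ N / Q := by
    rw [le_div_iff₀ hQ0]
    calc 4 * (C * N ^ ε) * Q = Q * (4 * C) * N ^ ε := by ring
      _ ≤ N ^ (1 - ε) * N ^ ε := mul_le_mul_of_nonneg_right h3 hNe
      _ = N := h2
  linarith

theorem per_scale (w : ℕ → ℕ)
    (hw_add : ∀ m n : ℕ, 1 ≤ m → 1 ≤ n → Nat.Coprime m n → w (m * n) = w m + w n)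
    (hw_prime : ∀ q : ℕ, Nat.Prime q → w q = 1)
    (C ε : ℝ) (hC : 0 < C) (hε : 0 < ε) (hε1 : ε < 1)
    (hw_bound : ∀ n : ℕ, 1 ≤ n → (w n : ℝ) ≤ C * (n : ℝ) ^ ε)
    (D : ℕ) (hCD : C ≤ D) (hD : ∀ n, 1 ≤ n → w n ≤ D * n)
    (T N J L X : ℕ) (hTL : T ≤ L)
    (hXd : D * (512 * (L + 1)) ^ 5 + L ≤ X) (hT2 : 2 ≤ T)
    (hN1 : 2 ^ (J ^ 8) ≤ N) (hN2 : N < 2 ^ L)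
    (e1 : 32 * (X + 1) * (1 + L) ≤ 2 ^ T)
    (e2 : 4 * (1 + J ^ 2 + 3 * (L + 1) ^ 2) ≤ 2 ^ T)
    (e3 : 4 * D ≤ 2 ^ T)
    (e4 : T + D * (512 * (T + 1)) ^ 5 ≤ J) (e5 : 3 ≤ (1 - ε) * J)
    (e6 : 512 * (L + 1) ≤ 2 ^ T) :
    (1 / 2 : ℝ) * (Xi w N : ℝ) ≤ (G w N : ℝ) := by
  obtain ⟨Q, hQ0, hQ, hx⟩ := Xi_lower w hw_add hw_prime D hD T N J L X hTL hXd hT2 hN1 hN2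
    e1 e2 e4 e6
  have hTJ : T ≤ J := le_trans (Nat.le_add_right _ _) e4
  have hfin := final_real_s2 C ε N Q (Xi w N) J T hε1 hC hTJ (by omega) e5
    (by
      have : (4 * D : ℝ) ≤ 2 ^ T := by exact_mod_cast e3
      linarith) (by exact_mod_cast hN1) (by exact_mod_cast hQ0) (by exact_mod_cast hQ) hx
  have hG := G_add_ge w N ⌊C * (N : ℝ) ^ ε⌋₊ (by
    intro n h1 h2
    apply Nat.le_floor
    refine (hw_bound n h1).trans ?_
    apply mul_le_mul_of_nonneg_left _ hC.le
    exact Real.rpow_le_rpow (by positivity) (by exact_mod_cast h2) hε.le)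
  have hfl : (⌊C * (N : ℝ) ^ ε⌋₊ : ℝ) ≤ C * (N : ℝ) ^ ε := Nat.floor_le (by positivity)
  have hG' : (Xi w N : ℝ) ≤ G w N + (⌊C * (N : ℝ) ^ ε⌋₊ : ℝ) := by exact_mod_cast hG
  linarith

theorem cond_all (D K T J L X : ℕ) (ε : ℝ) (hε1 : ε < 1) (hK : K = 1024 ^ 5)
    (h1 : (64 * (D * K + 2)) * (T + 1) ^ 288 ≤ 2 ^ T) (h2 : 56 * (T + 1) ^ 96 ≤ 2 ^ T)
    (h3 : 4 * D * (T + 1) ^ 0 ≤ 2 ^ T) (h4 : 1024 * (T + 1) ^ 48 ≤ 2 ^ T)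
    (h5 : 1 + D * K ≤ T) (h6 : 2 ≤ T) (h7 : ⌈3 / (1 - ε)⌉₊ ≤ T)
    (hJ : J = T ^ 6) (hL : L = (T + 1) ^ 48) (hX : X = D * (512 * (L + 1)) ^ 5 + L) :
    2 ≤ T ∧ 32 * (X + 1) * (1 + L) ≤ 2 ^ T ∧ 4 * (1 + J ^ 2 + 3 * (L + 1) ^ 2) ≤ 2 ^ T ∧
    4 * D ≤ 2 ^ T ∧ T + D * (512 * (T + 1)) ^ 5 ≤ J ∧ 3 ≤ (1 - ε) * J ∧
    512 * (L + 1) ≤ 2 ^ T := by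
  have hpos : 0 < 1 - ε := by linarith
  have b1 : 32 * (X + 1) * (1 + L) ≤ 2 ^ T :=
    (cond_e1 D K (T + 1) L X (Nat.succ_pos T) hL hX hK).trans h1
  have b2 : 4 * (1 + J ^ 2 + 3 * (L + 1) ^ 2) ≤ 2 ^ T := (cond_e2 T J L hJ hL).trans h2
  have b3 : 4 * D ≤ 2 ^ T := by
    rw [pow_zero, mul_one] at h3
    exact h3
  have b4 : T + D * (512 * (T + 1)) ^ 5 ≤ J := by
    rw [hJ]; exact cond_e4 D K T hK h5
  have a2' : T ≤ J := le_trans (Nat.le_add_right _ _) b4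
  have hU : 1 ≤ (T + 1) ^ 48 := Nat.one_le_pow _ _ (Nat.succ_pos T)
  rw [← hL] at h4 hU
  clear hL hX hJ h1 h2 hK
  refine ⟨h6, b1, b2, b3, b4, ?_, ?_⟩
  · clear b1 b2 b3 b4
    have a1 : 3 / (1 - ε) ≤ T := Nat.le_of_ceil_le h7
    have a2 : (T : ℝ) ≤ J := by exact_mod_cast a2'
    rw [div_le_iff₀ hpos] at a1
    nlinarith
  · clear b1 b2 b3 b4
    omega

theorem ev_cond (D : ℕ) (ε : ℝ) (hε1 : ε < 1) : ∀ᶠ T : ℕ in Filter.atTop, ∀ J L X : ℕ,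
    J = T ^ 6 → L = (T + 1) ^ 48 → X = D * (512 * (L + 1)) ^ 5 + L →
    2 ≤ T ∧ 32 * (X + 1) * (1 + L) ≤ 2 ^ T ∧ 4 * (1 + J ^ 2 + 3 * (L + 1) ^ 2) ≤ 2 ^ T ∧
    4 * D ≤ 2 ^ T ∧ T + D * (512 * (T + 1)) ^ 5 ≤ J ∧ 3 ≤ (1 - ε) * J ∧
    512 * (L + 1) ≤ 2 ^ T := by
  obtain ⟨K, hK⟩ : ∃ K : ℕ, K = 1024 ^ 5 := ⟨_, rfl⟩
  have g1 := ev_poly (64 * (D * K + 2)) 288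
  have g2 := ev_poly 56 96
  have g3 := ev_poly (4 * D) 0
  have g4 := ev_poly 1024 48
  filter_upwards [g1, g2, g3, g4, Filter.eventually_ge_atTop (1 + D * K),
    Filter.eventually_ge_atTop 2,
    Filter.eventually_ge_atTop ⌈3 / (1 - ε)⌉₊] with T h1 h2 h3 h4 h5 h6 h7 J L X hJ hL hX
  exact cond_all D K T J L X ε hε1 hK h1 h2 h3 h4 h5 h6 h7 hJ hL hX


/-- If `w n ≤ C·n^ε` for some `0 < ε < 1`, then `G(N) ≫ Ξ(N)`. -/
theorem G_gg_Xi (w : ℕ → ℕ)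
    (hw_add : ∀ m n : ℕ, 1 ≤ m → 1 ≤ n → Nat.Coprime m n → w (m * n) = w m + w n)
    (hw_prime : ∀ q : ℕ, Nat.Prime q → w q = 1)
    (C ε : ℝ) (hC : 0 < C) (hε : 0 < ε) (hε1 : ε < 1)
    (hw_bound : ∀ n : ℕ, 1 ≤ n → (w n : ℝ) ≤ C * (n : ℝ) ^ ε) :
    ∃ c : ℝ, 0 < c ∧ ∀ᶠ N : ℕ in Filter.atTop,
      c * (Xi w N : ℝ) ≤ (G w N : ℝ) := by
  obtain ⟨D, hD⟩ := exists_nat_ge C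
  have hDn : ∀ n, 1 ≤ n → w n ≤ D * n := by
    intro n hn
    have hn' : (1 : ℝ) ≤ n := by exact_mod_cast hn
    have h1 : (n : ℝ) ^ ε ≤ n := by
      calc (n : ℝ) ^ ε ≤ (n : ℝ) ^ (1 : ℝ) := Real.rpow_le_rpow_of_exponent_le hn' hε1.le
        _ = n := Real.rpow_one _
    have h2 : (w n : ℝ) ≤ D * n :=
      (hw_bound n hn).trans (mul_le_mul hD h1 (by positivity) (by positivity))
    exact_mod_cast h2
  obtain ⟨T0, hT0⟩ := Filter.eventually_atTop.1 (ev_cond D ε hε1)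
  refine ⟨1 / 2, by norm_num, ?_⟩
  filter_upwards [Filter.eventually_ge_atTop (2 ^ (T0 ^ 48))] with N hN
  obtain ⟨T, hT, hN1, hN2⟩ := exists_scale T0 N hN
  obtain ⟨J, hJ⟩ : ∃ J : ℕ, J = T ^ 6 := ⟨_, rfl⟩
  obtain ⟨L, hL⟩ : ∃ L : ℕ, L = (T + 1) ^ 48 := ⟨_, rfl⟩
  obtain ⟨X, hX⟩ : ∃ X : ℕ, X = D * (512 * (L + 1)) ^ 5 + L := ⟨_, rfl⟩
  obtain ⟨hT2, e1, e2, e3, e4, e5, e6⟩ := hT0 T hT J L X hJ hL hX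
  have hJ8 : T ^ 48 = J ^ 8 := by rw [hJ, ← pow_mul]
  rw [hJ8] at hN1
  rw [← hL] at hN2
  have hTL : T ≤ L := by
    rw [hL]
    exact (Nat.le_succ T).trans (Nat.le_self_pow (by norm_num) _)
  exact per_scale w hw_add hw_prime C ε hC hε hε1 hw_bound D hD hDn T N J L X hTL hX.ge hT2
    hN1 hN2 e1 e2 e3 e4 e5 e6
end
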